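/- arXiv:0708.1357 — 2 statements merged into one kernel-verified Lean document; each statement's English description precedes it below -/
import Mathlib

section
/- For every n ≥ 1, the number of involutions in S_n avoiding the pattern 54321 equals the number of involutions in S_n avoiding the pattern 45312; equivalently (since |I_n(12345)| = |I_n(54321)|), |I_n(12345)| = |I_n(45312)| for every n. This confirms Jaggard's conjecture for patterns of length 5. -/
/-- A permutation π of {0,…,n-1} contains the pattern τ of {0,…,k-1} if some
increasing sequence of positions induces values in the same relative order as τ. -/
def PermContains {n k : ℕ} (π : Equiv.Perm (Fin n)) (τ : Equiv.Perm (Fin k)) : Prop :=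
  ∃ f : Fin k → Fin n, StrictMono f ∧ ∀ a b : Fin k, τ a < τ b ↔ π (f a) < π (f b)

/-- |I_n(τ)|: the number of τ-avoiding involutions in the symmetric group S_n. -/
noncomputable def IAvoidCount (n : ℕ) {k : ℕ} (τ : Equiv.Perm (Fin k)) : ℕ :=
  {π : Equiv.Perm (Fin n) | π⁻¹ = π ∧ ¬ PermContains π τ}.ncard

/-- The pattern 54321 (one-line notation, here zero-based). -/
def p54321 : Equiv.Perm (Fin 5) := ⟨![4, 3, 2, 1, 0], ![4, 3, 2, 1, 0], by decide, by decide⟩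

/-- The pattern 45312 (one-line notation, here zero-based). -/
def p45312 : Equiv.Perm (Fin 5) := ⟨![3, 4, 2, 0, 1], ![3, 4, 2, 0, 1], by decide, by decide⟩

/-- The pattern 12345, i.e. the identity. -/
def p12345 : Equiv.Perm (Fin 5) := 1

/-- A growth diagram on the quarter plane for the filling `P`, written with row-index labels:
`H i j` is the label of the lower edge and `V i j` that of the left edge of the cell `(i, j)`
(the opposite edges being `H (i + 1) j` and `V i (j + 1)`). -/
structure IsGrowth (P : ℕ → ℕ → Prop) (H V : ℕ → ℕ → ℕ) : Prop where
  H_zero : ∀ j, H 0 j = 0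
  V_zero : ∀ i, V i 0 = 0
  pt : ∀ i j, P i j → H i j = 0 ∧ V i j = 0 ∧ H (i + 1) j = 1 ∧ V i (j + 1) = 1
  empty : ∀ i j, ¬ P i j → H i j = 0 → V i j = 0 → H (i + 1) j = 0 ∧ V i (j + 1) = 0
  pass : ∀ i j, H i j ≠ V i j → H (i + 1) j = H i j ∧ V i (j + 1) = V i j
  bump : ∀ i j, H i j = V i j → H i j ≠ 0 →
    H (i + 1) j = H i j + 1 ∧ V i (j + 1) = H i j + 1

/-- A chain of `d` cells of `S` with increasing first and decreasing second coordinates. -/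
def DecChain (S : ℕ → ℕ → Prop) (d : ℕ) : Prop :=
  ∃ x y : ℕ → ℕ, (∀ m < d, S (x m) (y m)) ∧ ∀ m, m + 1 < d → x m < x (m + 1) ∧ y (m + 1) < y m

/-- A chain of `k` cells of `P` in `[0, i) × [0, j)` with both coordinates increasing. -/
def IncChain (P : ℕ → ℕ → Prop) (k i j : ℕ) : Prop :=
  ∃ x y : ℕ → ℕ, (∀ m < k, P (x m) (y m) ∧ x m < i ∧ y m < j) ∧
    ∀ m, m + 1 < k → x m < x (m + 1) ∧ y m < y (m + 1)

namespace IsGrowth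

variable {P : ℕ → ℕ → Prop} {H V : ℕ → ℕ → ℕ}

/-- The four possible shapes of a cell of a growth diagram. -/
theorem cell (g : IsGrowth P H V) (i j : ℕ) :
    (P i j ∧ H i j = 0 ∧ V i j = 0 ∧ H (i + 1) j = 1 ∧ V i (j + 1) = 1) ∨
    (¬ P i j ∧ H i j = 0 ∧ V i j = 0 ∧ H (i + 1) j = 0 ∧ V i (j + 1) = 0) ∨
    (¬ P i j ∧ H i j ≠ V i j ∧ H (i + 1) j = H i j ∧ V i (j + 1) = V i j) ∨
    (¬ P i j ∧ H i j = V i j ∧ H i j ≠ 0 ∧ H (i + 1) j = H i j + 1 ∧ V i (j + 1) = H i j + 1) := by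
  have h1 := g.pt i j
  have h2 := g.empty i j
  have h3 := g.pass i j
  have h4 := g.bump i j
  by_cases hP : P i j
  · exact Or.inl ⟨hP, h1 hP⟩
  · by_cases e : H i j = V i j
    · by_cases z : H i j = 0
      · exact Or.inr (Or.inl ⟨hP, z, e ▸ z, h2 hP z (e ▸ z)⟩)
      · exact Or.inr (Or.inr (Or.inr ⟨hP, e, z, h4 e z⟩))
    · exact Or.inr (Or.inr (Or.inl ⟨hP, e, h3 e⟩))

theorem swap (g : IsGrowth P H V) :
    IsGrowth (fun i j => P j i) (fun i j => V j i) (fun i j => H j i) where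
  H_zero := g.V_zero
  V_zero := g.H_zero
  pt i j h := by have := g.pt j i h; tauto
  empty i j h := by have := g.empty j i h; tauto
  pass i j h := by have := g.pass j i (Ne.symm h); tauto
  bump i j h h' := by
    have := g.bump j i h.symm (h ▸ h')
    rw [h]; tauto

/-- Where the label `r` of a lower edge was created. -/
theorem traceH (g : IsGrowth P H V) {r : ℕ} (hr : r ≠ 0) (j : ℕ) : ∀ i, H i j = r →
    ∃ i₀ < i, (H (i₀ + 1) j = r ∧ V i₀ (j + 1) = r) ∧ ∀ i', i₀ < i' → i' ≤ i → H i' j = r := by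
  intro i
  induction i with
  | zero => intro h; exact absurd (h.symm.trans (g.H_zero j)) hr
  | succ i ih =>
    intro h
    by_cases hS : V i (j + 1) = r
    · refine ⟨i, by omega, ⟨h, hS⟩, fun i' h1 h2 => ?_⟩
      obtain rfl : i' = i + 1 := by omega
      exact h
    · have hi : H i j = r := by
        have := g.cell i j
        omega
      obtain ⟨i₀, h0, h1, h2⟩ := ih hi
      refine ⟨i₀, by omega, h1, fun i' h3 h4 => ?_⟩
      rcases Nat.lt_or_ge i i' with h5 | h5
      · obtain rfl : i' = i + 1 := by omega
        exact h
      · exact h2 i' h3 h5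

/-- A label of a lower edge propagates until it is bumped. -/
theorem forwardH (g : IsGrowth P H V) {r : ℕ} (_hr : r ≠ 0) (i j : ℕ) (h : H i j = r) :
    ∀ i₁, i ≤ i₁ → H i₁ j = r ∨
      ∃ i', i ≤ i' ∧ i' < i₁ ∧ H (i' + 1) j = r + 1 ∧ V i' (j + 1) = r + 1 := by
  intro i₁ hi
  induction i₁, hi using Nat.le_induction with
  | base => exact Or.inl h
  | succ k hk ih =>
    rcases ih with ih | ⟨i', h1, h2, h3⟩
    · by_cases e : H (k + 1) j = r
      · exact Or.inl e
      · refine Or.inr ⟨k, hk, by omega, ?_⟩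
        have := g.cell k j
        omega
    · exact Or.inr ⟨i', h1, by omega, h3⟩

theorem decChain_raise (g : IsGrowth P H V) {r d : ℕ} (hr : r ≠ 0)
    (h : DecChain (fun i j => H (i + 1) j = r ∧ V i (j + 1) = r) (d + 1)) :
    DecChain (fun i j => H (i + 1) j = r + 1 ∧ V i (j + 1) = r + 1) d := by
  obtain ⟨x, y, hS, hc⟩ := h
  have key : ∀ k, ∃ p q, k < d → (H (p + 1) q = r + 1 ∧ V p (q + 1) = r + 1) ∧
      x k < p ∧ p ≤ x (k + 1) ∧ y (k + 1) < q ∧ q ≤ y k := by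
    intro k
    by_cases hk : k < d
    swap
    · exact ⟨0, 0, fun h => absurd h hk⟩
    obtain ⟨hx, hy⟩ := hc k (by omega)
    rcases g.forwardH hr _ _ (hS k (by omega)).1 (x (k + 1)) hx with h1 | ⟨p, h1, h2, h3⟩
    · rcases g.swap.forwardH hr _ _ (hS (k + 1) (by omega)).2 (y k) hy with h2 | ⟨q, h2, h3, h4⟩
      · refine ⟨x (k + 1), y k, fun _ => ⟨?_, hx, le_rfl, hy, le_rfl⟩⟩
        have := g.bump (x (k + 1)) (y k) (h1.trans h2.symm) (h1 ▸ hr)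
        omega
      · exact ⟨x (k + 1), q, fun _ => ⟨⟨h4.2, h4.1⟩, hx, le_rfl, by omega, by omega⟩⟩
    · exact ⟨p, y k, fun _ => ⟨h3, by omega, by omega, hy, le_rfl⟩⟩
  choose p q hpq using key
  refine ⟨p, q, fun m hm => (hpq m hm).1, fun m hm => ?_⟩
  have h1 := hpq m (by omega)
  have h2 := hpq (m + 1) hm
  omega

theorem decChain_lower (g : IsGrowth P H V) {r d : ℕ} (hr : r ≠ 0) (hd : d ≠ 0)
    (h : DecChain (fun i j => H (i + 1) j = r + 1 ∧ V i (j + 1) = r + 1) d) :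
    DecChain (fun i j => H (i + 1) j = r ∧ V i (j + 1) = r) (d + 1) := by
  obtain ⟨x, y, hS, hc⟩ := h
  have hin : ∀ m < d, H (x m) (y m) = r ∧ V (x m) (y m) = r := by
    intro m hm
    have h1 := hS m hm
    have h2 := g.cell (x m) (y m)
    omega
  have key : ∀ k, ∃ p q, k ≤ d → (H (p + 1) q = r ∧ V p (q + 1) = r) ∧
      (0 < k → x (k - 1) ≤ p ∧ q < y (k - 1)) ∧ (k < d → p < x k ∧ y k ≤ q) := by
    intro k
    by_cases hkd : k < d
    · obtain ⟨i₀, hi₀, hi₁, hi₂⟩ := g.traceH hr _ _ (hin k hkd).1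
      rcases Nat.eq_zero_or_pos k with rfl | hk
      · exact ⟨i₀, y 0, fun _ => ⟨hi₁, by omega, by omega⟩⟩
      obtain ⟨l, rfl⟩ : ∃ l, k = l + 1 := ⟨k - 1, by omega⟩
      obtain ⟨j₀, hj₀, hj₁, hj₂⟩ := g.swap.traceH hr _ _ (hin l (by omega)).2
      obtain ⟨hx, hy⟩ := hc l hkd
      by_cases h1 : x l ≤ i₀
      · exact ⟨i₀, y (l + 1), fun _ => ⟨hi₁, fun _ => ⟨h1, hy⟩, fun _ => ⟨hi₀, le_rfl⟩⟩⟩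
      by_cases h2 : y (l + 1) ≤ j₀
      · exact ⟨x l, j₀, fun _ => ⟨hj₁.symm, fun _ => ⟨le_rfl, hj₀⟩, fun _ => ⟨hx, h2⟩⟩⟩
      exfalso
      have h3 := hi₂ (x l) (by omega) (by omega)
      have h4 := hi₂ (x l + 1) (by omega) (by omega)
      have h5 := hj₂ (y (l + 1)) (by omega) (by omega)
      have h6 := g.cell (x l) (y (l + 1))
      omega
    · by_cases hk : k = d
      · subst hk
        obtain ⟨l, rfl⟩ : ∃ l, k = l + 1 := ⟨k - 1, by omega⟩
        obtain ⟨j₀, hj₀, hj₁, hj₂⟩ := g.swap.traceH hr _ _ (hin l (by omega)).2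
        exact ⟨x l, j₀, fun _ => ⟨hj₁.symm, fun _ => ⟨le_rfl, hj₀⟩, by omega⟩⟩
      · exact ⟨0, 0, by omega⟩
  choose p q hpq using key
  refine ⟨p, q, fun m hm => (hpq m (by omega)).1, fun m hm => ?_⟩
  have h1 := (hpq m (by omega)).2.2 (by omega)
  have h2 := (hpq (m + 1) (by omega)).2.1 (by omega)
  simp only [Nat.add_sub_cancel] at h2
  omega

theorem decChain_add (g : IsGrowth P H V) (d : ℕ) : ∀ {r : ℕ}, r ≠ 0 →
    (DecChain (fun i j => H (i + 1) j = r ∧ V i (j + 1) = r) (d + 1) ↔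
      DecChain (fun i j => H (i + 1) j = r + d ∧ V i (j + 1) = r + d) 1) := by
  induction d with
  | zero => intro r _; rfl
  | succ d ih =>
    intro r hr
    rw [show r + (d + 1) = r + 1 + d by ring, ← ih (Nat.succ_ne_zero r)]
    exact ⟨g.decChain_raise hr, g.decChain_lower hr (Nat.succ_ne_zero d)⟩

theorem monoH (g : IsGrowth P H V) (j : ℕ) : Monotone (fun i => H i j) := by
  refine monotone_nat_of_le_succ fun i => ?_
  have := g.cell i j
  omega

theorem pt_iff (g : IsGrowth P H V) (i j : ℕ) : P i j ↔ H (i + 1) j = 1 ∧ V i (j + 1) = 1 := by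
  have := g.cell i j
  constructor
  · intro h
    have := g.pt i j h
    omega
  · intro h
    by_contra hP
    simp only [hP, not_false_eq_true, true_and, false_and, false_or] at this
    omega

/-- Decreasing chains are detected by the largest label. -/
theorem decChain_iff (g : IsGrowth P H V) {n d : ℕ} (hP : ∀ i j, P i j → i < n) (hd : d ≠ 0) :
    DecChain P d ↔ ∃ j, d ≤ H n j := by
  have hPS : P = fun i j => H (i + 1) j = 1 ∧ V i (j + 1) = 1 := by
    funext i j; exact propext (g.pt_iff i j)
  obtain ⟨d, rfl⟩ := Nat.exists_eq_succ_of_ne_zero hd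
  constructor
  · intro h
    have hcH : ∀ j i, n ≤ i → H i j = H n j := by
      intro j i hi
      induction i, hi using Nat.le_induction with
      | base => rfl
      | succ k hk ih =>
        have h1 : V k j = 0 := by
          by_contra h0
          have hz : ∀ m, V k m = 0 := by
            intro m
            induction m with
            | zero => exact g.V_zero k
            | succ m ihm =>
              have h2 := g.cell k m
              have h3 : ¬ P k m := fun h => absurd (hP _ _ h) (by omega)
              simp only [h3, not_false_eq_true, true_and, false_and, false_or] at h2
              omega
          exact h0 (hz j)
        have h2 := g.cell k j
        have h3 : ¬ P k j := fun h => absurd (hP _ _ h) (by omega)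
        simp only [h3, not_false_eq_true, true_and, false_and, false_or] at h2
        omega
    rw [hPS] at h
    obtain ⟨x, y, hS, -⟩ := (g.decChain_add d one_ne_zero).1 h
    have h1 := (hS 0 one_pos).1
    refine ⟨y 0, ?_⟩
    rcases le_total (x 0 + 1) n with h2 | h2
    · have := g.monoH (y 0) h2
      simp only at this
      omega
    · rw [← hcH (y 0) _ h2]; omega
  · rintro ⟨j, hj⟩
    obtain ⟨i₀, -, h1, -⟩ := g.traceH (r := H n j) (by omega) j n rfl
    obtain ⟨e, he⟩ : ∃ e, H n j = 1 + e := ⟨H n j - 1, by omega⟩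
    rw [he] at h1
    have h2 := (g.decChain_add e one_ne_zero).2
      ⟨fun _ => i₀, fun _ => j, fun _ _ => h1, by omega⟩
    rw [← hPS] at h2
    obtain ⟨x, y, h3, h4⟩ := h2
    exact ⟨x, y, fun m hm => h3 m (by omega), fun m hm => h4 m (by omega)⟩

/-- The local rule for the partitions at the corners of the cells. -/
theorem count_succ (g : IsGrowth P H V) (i : ℕ) {a : ℕ} (ha : a ≠ 0) (j : ℕ) :
    Nat.count (fun x => H (i + 1) x = a) j =
      Nat.count (fun x => H i x = a) j + if V i j = a then 1 else 0 := by
  induction j with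
  | zero => simp [g.V_zero, ha.symm]
  | succ j ih =>
    rw [Nat.count_succ, Nat.count_succ, ih]
    have := g.cell i j
    split_ifs <;> omega

theorem ballot (g : IsGrowth P H V) (i : ℕ) : ∀ j a, a ≠ 0 →
    Nat.count (fun x => H i x = a + 1) j ≤ Nat.count (fun x => H i x = a) j := by
  induction i with
  | zero => intro j a ha; simp [g.H_zero]
  | succ i ih =>
    intro j
    induction j with
    | zero => simp
    | succ j ihj =>
      intro a ha
      have h1 := ihj a ha
      have h2 := ih (j + 1) a ha
      have h3 := ih j a ha
      rw [g.count_succ i ha, g.count_succ i (show a + 1 ≠ 0 by omega)] at h1 ⊢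
      rw [Nat.count_succ, Nat.count_succ] at h2 ⊢
      have := g.cell i j
      split_ifs at * <;> omega

theorem incChain_count (g : IsGrowth P H V) (i : ℕ) : ∀ j,
    IncChain P (Nat.count (fun x => H i x = 1) j) i j := by
  induction i with
  | zero => intro j; simp [g.H_zero, IncChain]
  | succ i ih =>
    intro j
    induction j with
    | zero => simp [IncChain]
    | succ j ihj =>
      by_cases hP : P i j
      · have h1 : Nat.count (fun x => H (i + 1) x = 1) (j + 1) =
            Nat.count (fun x => H i x = 1) j + 1 := by
          have := g.pt i j hP
          rw [Nat.count_succ, g.count_succ i one_ne_zero]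
          simp [this]
        rw [h1]
        obtain ⟨x, y, h2, h3⟩ := ih j
        set k := Nat.count (fun x => H i x = 1) j
        refine ⟨fun m => if m < k then x m else i, fun m => if m < k then y m else j, ?_, ?_⟩
        · intro m hm
          by_cases hk : m < k
          · have := h2 m hk
            simp only [hk, if_true]
            exact ⟨this.1, by omega, by omega⟩
          · simp only [hk, if_false]
            exact ⟨hP, by omega, by omega⟩
        · intro m hm
          have hk : m < k := by omega
          by_cases hk' : m + 1 < k
          · simpa [hk, hk'] using h3 m hk'
          · simpa [hk, hk'] using (h2 m hk).2
      · by_cases h1 : H (i + 1) j = 1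
        · have h2 : Nat.count (fun x => H (i + 1) x = 1) (j + 1) =
              Nat.count (fun x => H i x = 1) (j + 1) := by
            rw [g.count_succ i one_ne_zero]
            have := g.cell i j
            simp only [hP, not_false_eq_true, true_and, false_and, false_or] at this
            rw [if_neg (by omega), add_zero]
          rw [h2]
          obtain ⟨x, y, h2, h3⟩ := ih (j + 1)
          exact ⟨x, y, fun m hm => ⟨(h2 m hm).1, by have := h2 m hm; omega, (h2 m hm).2.2⟩, h3⟩
        · rw [Nat.count_succ, if_neg h1, add_zero]
          obtain ⟨x, y, h2, h3⟩ := ihj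
          exact ⟨x, y, fun m hm => ⟨(h2 m hm).1, (h2 m hm).2.1, by have := h2 m hm; omega⟩, h3⟩

theorem count_mono (g : IsGrowth P H V) {i i' j j' : ℕ} (hi : i ≤ i') (hj : j ≤ j') :
    Nat.count (fun x => H i x = 1) j ≤ Nat.count (fun x => H i' x = 1) j' := by
  refine le_trans ?_ (Nat.count_monotone _ hj)
  induction i', hi using Nat.le_induction with
  | base => rfl
  | succ k hk ih => rw [g.count_succ k one_ne_zero]; omega

/-- Increasing chains are detected by the number of labels `1`. -/
theorem incChain_iff (g : IsGrowth P H V) (k i j : ℕ) :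
    IncChain P k i j ↔ k ≤ Nat.count (fun x => H i x = 1) j := by
  constructor
  · rintro ⟨x, y, h1, h2⟩
    have key : ∀ m < k, m + 1 ≤ Nat.count (fun z => H (x m + 1) z = 1) (y m + 1) := by
      have hs : ∀ m < k, Nat.count (fun z => H (x m) z = 1) (y m) + 1 ≤
          Nat.count (fun z => H (x m + 1) z = 1) (y m + 1) := by
        intro m hm
        have := g.pt _ _ (h1 m hm).1
        rw [Nat.count_succ, g.count_succ _ one_ne_zero]
        simp [this]
      intro m
      induction m with
      | zero => intro hm; have := hs 0 hm; omega
      | succ m ih =>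
        intro hm
        have h3 := ih (by omega)
        have h4 := hs (m + 1) hm
        have h5 := g.count_mono (i := x m + 1) (j := y m + 1) (h2 m hm).1 (h2 m hm).2
        omega
    rcases Nat.eq_zero_or_pos k with rfl | hk
    · exact Nat.zero_le _
    · have h3 := key (k - 1) (by omega)
      have h4 := h1 (k - 1) (by omega)
      have h5 := g.count_mono (show x (k - 1) + 1 ≤ i by omega) (show y (k - 1) + 1 ≤ j by omega)
      omega
  · intro h
    obtain ⟨x, y, h1, h2⟩ := g.incChain_count i j
    exact ⟨x, y, fun m hm => h1 m (by omega), fun m hm => h2 m (by omega)⟩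

theorem symm (g : IsGrowth P H V) (hP : ∀ i j, P i j → P j i) : ∀ i j, H i j = V j i := by
  suffices h : ∀ s i j, i + j = s → H i j = V j i from fun i j => h _ i j rfl
  intro s
  induction s using Nat.strong_induction_on with
  | _ s ih =>
    intro i j hs
    cases i with
    | zero => rw [g.H_zero, g.V_zero]
    | succ i =>
      have h1 := ih (i + j) (by omega) i j rfl
      have h2 := ih (i + j) (by omega) j i (by omega)
      have c1 := g.cell i j
      have c2 := g.cell j i
      by_cases h : P i j
      · have := hP _ _ h
        have h3 := g.pt _ _ h
        have h4 := g.pt _ _ this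
        omega
      · have h' : ¬ P j i := fun h' => h (hP _ _ h')
        simp only [h, h', not_false_eq_true, true_and, false_and, false_or] at c1 c2
        omega

theorem H_ne_zero_iff (g : IsGrowth P H V) (j : ℕ) : ∀ i, H i j ≠ 0 ↔ ∃ i' < i, P i' j := by
  intro i
  induction i with
  | zero => simp [g.H_zero]
  | succ i ih =>
    have c := g.cell i j
    have : (∃ i' < i + 1, P i' j) ↔ (∃ i' < i, P i' j) ∨ P i j := by
      constructor
      · rintro ⟨i', h1, h2⟩
        rcases Nat.lt_or_ge i' i with h | h
        · exact Or.inl ⟨i', h, h2⟩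
        · obtain rfl : i' = i := by omega
          exact Or.inr h2
      · rintro (⟨i', h1, h2⟩ | h)
        · exact ⟨i', by omega, h2⟩
        · exact ⟨i, by omega, h⟩
    rw [this, ← ih]
    by_cases h : P i j
    · simp only [h, or_true, iff_true]
      have := g.pt i j h
      omega
    · simp only [h, or_false]
      simp only [h, not_false_eq_true, true_and, false_and, false_or] at c
      omega

end IsGrowth

open Classical in
/-- The left edges of a row of the growth diagram with points `p` and lower edges `h`. -/
noncomputable def growV (p : ℕ → Prop) (h : ℕ → ℕ) : ℕ → ℕ
  | 0 => 0
  | j + 1 => if p j then 1 else if h j = growV p h j ∧ h j ≠ 0 then h j + 1 else growV p h j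

open Classical in
/-- The lower edges of the growth diagram of `P`. -/
noncomputable def growH (P : ℕ → ℕ → Prop) : ℕ → ℕ → ℕ
  | 0 => fun _ => 0
  | i + 1 => fun j => if P i j then 1 else
      if growH P i j = growV (P i) (growH P i) j ∧ growH P i j ≠ 0 then growH P i j + 1
      else growH P i j

theorem exists_of_growV_ne_zero (p : ℕ → Prop) (h : ℕ → ℕ) (j : ℕ) (hj : growV p h j ≠ 0) :
    ∃ j' < j, p j' := by
  induction j with
  | zero => exact absurd rfl hj
  | succ j ih =>
    by_cases hp : p j
    · exact ⟨j, by omega, hp⟩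
    · have : growV p h j ≠ 0 := by
        intro h0
        rw [growV, if_neg hp, h0] at hj
        split_ifs at hj with h1
        · exact h1.2 h1.1
        · exact hj rfl
      obtain ⟨j', h1, h2⟩ := ih this
      exact ⟨j', by omega, h2⟩

theorem exists_of_growH_ne_zero (P : ℕ → ℕ → Prop) (i j : ℕ) (hi : growH P i j ≠ 0) :
    ∃ i' < i, P i' j := by
  induction i with
  | zero => exact absurd rfl hi
  | succ i ih =>
    by_cases hp : P i j
    · exact ⟨i, by omega, hp⟩
    · have : growH P i j ≠ 0 := by
        intro h0
        simp [growH, hp, h0] at hi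
      obtain ⟨j', h1, h2⟩ := ih this
      exact ⟨j', by omega, h2⟩

theorem isGrowth_grow {P : ℕ → ℕ → Prop} (hrow : ∀ i j j', P i j → P i j' → j = j')
    (hcol : ∀ i i' j, P i j → P i' j → i = i') :
    IsGrowth P (growH P) (fun i => growV (P i) (growH P i)) where
  H_zero _ := rfl
  V_zero _ := rfl
  pt i j h := by
    refine ⟨?_, ?_, by simp [growH, h], by simp [growV, h]⟩
    · by_contra h0
      obtain ⟨i', h1, h2⟩ := exists_of_growH_ne_zero P i j h0
      have := hcol _ _ _ h h2
      omega
    · by_contra h0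
      obtain ⟨j', h1, h2⟩ := exists_of_growV_ne_zero _ _ j h0
      have := hrow _ _ _ h h2
      omega
  empty i j h h1 h2 := by simp [growH, growV, h, h1, h2]
  pass i j h := by
    have : ¬ P i j := by
      intro hp
      refine h ?_
      by_cases h0 : growH P i j = 0
      · by_cases h1 : growV (P i) (growH P i) j = 0
        · rw [h0, h1]
        · obtain ⟨j', h1, h2⟩ := exists_of_growV_ne_zero _ _ j h1
          have := hrow _ _ _ hp h2
          omega
      · obtain ⟨i', h1, h2⟩ := exists_of_growH_ne_zero P i j h0
        have := hcol _ _ _ hp h2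
        omega
    simp [growH, growV, h, this]
  bump i j h h0 := by
    have : ¬ P i j := by
      intro hp
      obtain ⟨i', h1, h2⟩ := exists_of_growH_ne_zero P i j h0
      have := hcol _ _ _ hp h2
      omega
    simp only [growH, growV, if_neg this]
    rw [if_pos ⟨h, h0⟩, if_pos ⟨h, h0⟩]
    exact ⟨rfl, rfl⟩

/-- A symmetric growth diagram is determined by its upper boundary. -/
theorem IsGrowth.unique {P P' : ℕ → ℕ → Prop} {H V H' V' : ℕ → ℕ → ℕ} (g : IsGrowth P H V)
    (g' : IsGrowth P' H' V') (hP : ∀ i j, P i j → P j i) (hP' : ∀ i j, P' i j → P' j i) {n : ℕ}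
    (h : ∀ j, H n j = H' n j) {i j : ℕ} (hi : i < n) (hj : j < n) : P i j ↔ P' i j := by
  have key : ∀ s i j, i ≤ n → j < n → n - i + (n - j) = s → H i j = H' i j := by
    intro s
    induction s with
    | zero => intro i j h1 h2 h3; omega
    | succ s ih =>
      intro i j h1 h2 h3
      rcases Nat.eq_or_lt_of_le h1 with rfl | h1
      · exact h j
      · have e1 := ih (i + 1) j (by omega) h2 (by omega)
        have e2 := ih (j + 1) i (by omega) h1 (by omega)
        rw [g.symm hP, g'.symm hP'] at e2
        have c := g.cell i j
        have c' := g'.cell i j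
        omega
  rw [g.pt_iff, g'.pt_iff, ← g.symm hP, ← g'.symm hP', key _ (i + 1) j (by omega) hj rfl,
    key _ (j + 1) i (by omega) hi rfl]

/-- The local rules of a growth diagram read backwards from a symmetric boundary `c`, in
reversed coordinates. -/
structure IsUngrowth (c : ℕ → ℕ) (K W : ℕ → ℕ → ℕ) : Prop where
  K_zero : ∀ v, K 0 v = c v
  W_zero : ∀ u, W u 0 = c u
  K_succ : ∀ u v, K (u + 1) v = if K u v = W u v then K u v - 1 else K u v
  W_succ : ∀ u v, W u (v + 1) = if K u v = W u v then W u v - 1 else W u v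

/-- The vertical edges of a row of a reversed growth diagram. -/
def ungrowV (h : ℕ → ℕ) (a : ℕ) : ℕ → ℕ
  | 0 => a
  | v + 1 => if h v = ungrowV h a v then ungrowV h a v - 1 else ungrowV h a v

/-- The horizontal edges of a reversed growth diagram. -/
def ungrowH (c : ℕ → ℕ) : ℕ → ℕ → ℕ
  | 0 => c
  | u + 1 => fun v => if ungrowH c u v = ungrowV (ungrowH c u) (c u) v then ungrowH c u v - 1
      else ungrowH c u v

theorem isUngrowth_ungrow (c : ℕ → ℕ) :
    IsUngrowth c (ungrowH c) (fun u => ungrowV (ungrowH c u) (c u)) :=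
  ⟨fun _ => rfl, fun _ => rfl, fun _ _ => rfl, fun _ _ => rfl⟩

/-- Words `c` of length `n` in the positive integers all of whose prefixes contain at least as
many letters `a` as letters `a + 1`; they encode standard Young tableaux with `n` cells. -/
structure IsBallot (n : ℕ) (c : ℕ → ℕ) : Prop where
  support : ∀ j, c j ≠ 0 ↔ j < n
  count_le : ∀ j a, a ≠ 0 →
    Nat.count (fun x => c x = a + 1) j ≤ Nat.count (fun x => c x = a) j

theorem IsBallot.exists_bound {n : ℕ} {c : ℕ → ℕ} (hc : IsBallot n c) : ∃ B, ∀ j, c j ≤ B := by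
  refine ⟨(Finset.range n).sup c, fun j => ?_⟩
  by_cases h : j < n
  · exact Finset.le_sup (f := c) (Finset.mem_range.2 h)
  · have := mt (hc.support j).1 h
    omega

namespace IsUngrowth

variable {c : ℕ → ℕ} {K W : ℕ → ℕ → ℕ}

theorem symm (g : IsUngrowth c K W) : ∀ u v, K u v = W v u := by
  suffices h : ∀ s u v, u + v = s → K u v = W v u from fun u v => h _ u v rfl
  intro s
  induction s using Nat.strong_induction_on with
  | _ s ih =>
    intro u v hs
    cases u with
    | zero => rw [g.K_zero, g.W_zero]
    | succ u =>
      have h1 := ih (u + v) (by omega) u v rfl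
      have h2 := ih (u + v) (by omega) v u (by omega)
      rw [g.K_succ, g.W_succ, ← h1, h2]
      simp only [eq_comm]

theorem le_bound (g : IsUngrowth c K W) {B : ℕ} (hB : ∀ v, c v ≤ B) (u v : ℕ) : K u v ≤ B := by
  induction u with
  | zero => rw [g.K_zero]; exact hB v
  | succ u ih => rw [g.K_succ]; split_ifs <;> omega

end IsUngrowth

/-- The number of entries `a` of the partition at a corner of the reversed growth diagram. -/
def ungrowCount (n : ℕ) (c : ℕ → ℕ) (W : ℕ → ℕ → ℕ) (u v a : ℕ) : ℤ :=
  Nat.count (fun x => c x = a) (n - v) - Nat.count (fun x => W x v = a) u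

section

variable {n : ℕ} {c : ℕ → ℕ} {K W : ℕ → ℕ → ℕ}

theorem ungrowCount_succ_left (u v a : ℕ) : ungrowCount n c W (u + 1) v a =
    ungrowCount n c W u v a - if W u v = a then 1 else 0 := by
  unfold ungrowCount
  rw [Nat.count_succ]
  push_cast
  ring

theorem ungrowCount_succ_right (g : IsUngrowth (fun v => c (n - 1 - v)) K W) (u : ℕ) {v a : ℕ}
    (hv : v < n) (_ha : a ≠ 0) : ungrowCount n c W u (v + 1) a =
    ungrowCount n c W u v a - if K u v = a then 1 else 0 := by
  induction u with
  | zero =>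
    have h : n - v = n - 1 - v + 1 := by omega
    have h' : n - (v + 1) = n - 1 - v := by omega
    unfold ungrowCount
    rw [g.K_zero, h, h', Nat.count_succ]
    push_cast
    simp
  | succ u ih =>
    rw [ungrowCount_succ_left, ungrowCount_succ_left, ih, g.K_succ, g.W_succ]
    split_ifs <;> omega

theorem ungrowCount_right_zero (g : IsUngrowth (fun v => c (n - 1 - v)) K W) {u : ℕ} (a : ℕ)
    (hu : u ≤ n) : ungrowCount n c W u 0 a = Nat.count (fun x => c x = a) (n - u) := by
  induction u with
  | zero => simp [ungrowCount]
  | succ u ih =>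
    have h : n - u = n - 1 - u + 1 := by omega
    have h' : n - (u + 1) = n - 1 - u := by omega
    rw [ungrowCount_succ_left, ih (by omega), g.W_zero, h, h', Nat.count_succ]
    push_cast
    ring

theorem ungrowCount_antitone (hc : IsBallot n c) (g : IsUngrowth (fun v => c (n - 1 - v)) K W)
    {u : ℕ} (hu : u ≤ n) : ∀ {v}, v ≤ n → ∀ {a}, a ≠ 0 →
    ungrowCount n c W u v (a + 1) ≤ ungrowCount n c W u v a := by
  induction u with
  | zero =>
    intro v _ a ha
    simpa [ungrowCount] using hc.count_le (n - v) a ha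
  | succ u ih =>
    intro v
    induction v with
    | zero =>
      intro _ a ha
      rw [ungrowCount_right_zero g _ hu, ungrowCount_right_zero g _ hu]
      exact_mod_cast hc.count_le _ a ha
    | succ v ihv =>
      intro hv a ha
      have h1 := ih (by omega) (show v ≤ n by omega) ha
      have h2 := ih (by omega) hv ha
      have h3 := ihv (by omega) ha
      have ha' : a + 1 ≠ 0 := by omega
      have hv' : v < n := by omega
      rw [ungrowCount_succ_right g _ hv' ha, ungrowCount_succ_right g _ hv' ha'] at h2
      rw [ungrowCount_succ_left, ungrowCount_succ_left] at h3
      rw [ungrowCount_succ_left, ungrowCount_succ_left, ungrowCount_succ_right g _ hv' ha,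
        ungrowCount_succ_right g _ hv' ha', g.W_succ]
      split_ifs at * <;> omega

theorem ungrowCount_nonneg (hc : IsBallot n c) (g : IsUngrowth (fun v => c (n - 1 - v)) K W)
    {u v a : ℕ} (hu : u ≤ n) (hv : v ≤ n) (ha : a ≠ 0) : 0 ≤ ungrowCount n c W u v a := by
  obtain ⟨B, hB⟩ := hc.exists_bound
  have h1 : ∀ k, ungrowCount n c W u v (a + k) ≤ ungrowCount n c W u v a := by
    intro k
    induction k with
    | zero => rfl
    | succ k ih => exact (ungrowCount_antitone hc g hu hv (a := a + k) (by omega)).trans ih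
  refine le_trans (le_of_eq ?_) (h1 (B + 1))
  unfold ungrowCount
  rw [(Nat.count_iff_forall_not).2, (Nat.count_iff_forall_not).2]
  · simp
  · intro m _
    have := g.le_bound (fun v => hB (n - 1 - v)) v m
    rw [g.symm] at this
    omega
  · intro m _
    have := hB m
    omega

theorem IsUngrowth.eq_zero (hc : IsBallot n c) (g : IsUngrowth (fun v => c (n - 1 - v)) K W)
    {v : ℕ} (hv : v < n) : K n v = 0 := by
  by_contra ha
  have h1 : ∀ w ≤ n, ungrowCount n c W n w (K n v) ≤ 0 := by
    intro w
    induction w with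
    | zero => intro _; rw [ungrowCount_right_zero g _ le_rfl]; simp
    | succ w ih =>
      intro hw
      have := ih (by omega)
      rw [ungrowCount_succ_right g _ (by omega) ha]
      split_ifs <;> omega
  have h2 := h1 v hv.le
  have h3 := ungrowCount_nonneg hc g le_rfl (show v + 1 ≤ n from hv) ha
  rw [ungrowCount_succ_right g _ hv ha, if_pos rfl] at h3
  omega

theorem IsUngrowth.existsUnique (hc : IsBallot n c)
    (g : IsUngrowth (fun v => c (n - 1 - v)) K W) {u : ℕ} (hu : u < n) :
    ∃ v < n, (K u v = 1 ∧ W u v = 1) ∧ ∀ v', K u v' = 1 → W u v' = 1 → v' = v := by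
  have hlast : W u n = 0 := by rw [← g.symm]; exact g.eq_zero hc hu
  have hfirst : W u 0 ≠ 0 := by
    rw [g.W_zero, hc.support]; omega
  have hex : ∃ v < n, W u v ≠ 0 ∧ W u (v + 1) = 0 := by
    by_contra! h
    have : ∀ v ≤ n, W u v ≠ 0 := by
      intro v
      induction v with
      | zero => exact fun _ => hfirst
      | succ v ih => exact fun hv => h v (by omega) (ih (by omega))
    exact this n le_rfl hlast
  obtain ⟨v, hv, h1, h2⟩ := hex
  have h3 : K u v = 1 ∧ W u v = 1 := by
    rw [g.W_succ] at h2
    split_ifs at h2 <;> omega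
  have hz : ∀ v v', K u v = 1 → W u v = 1 → v < v' → W u v' = 0 := by
    intro v v' e1 e2 hlt
    induction v', Nat.succ_le_of_lt hlt using Nat.le_induction with
    | base => rw [g.W_succ, e1, e2]; simp
    | succ k hk ih => rw [g.W_succ, ih hk]; simp
  refine ⟨v, hv, h3, fun v' e1 e2 => ?_⟩
  rcases lt_trichotomy v v' with h | h | h
  · have := hz v v' h3.1 h3.2 h
    omega
  · exact h.symm
  · have := hz v' v e1 e2 h
    omega

end

/-- The permutation matrix of `π`, extended by zeros to the quarter plane. -/
def permFill {n : ℕ} (π : Equiv.Perm (Fin n)) (i j : ℕ) : Prop :=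
  ∃ (hi : i < n) (hj : j < n), π ⟨i, hi⟩ = ⟨j, hj⟩

theorem isGrowth_permFill {n : ℕ} (π : Equiv.Perm (Fin n)) :
    IsGrowth (permFill π) (growH (permFill π))
      (fun i => growV (permFill π i) (growH (permFill π) i)) := by
  apply isGrowth_grow
  · rintro i j j' ⟨hi, hj, h⟩ ⟨_, hj', h'⟩
    simpa using h.symm.trans h'
  · rintro i i' j ⟨hi, hj, h⟩ ⟨hi', _, h'⟩
    simpa using π.injective (h.trans h'.symm)

theorem permFill_symm {n : ℕ} {π : Equiv.Perm (Fin n)} (h : π⁻¹ = π) (i j : ℕ)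
    (hP : permFill π i j) : permFill π j i := by
  obtain ⟨hi, hj, e⟩ := hP
  refine ⟨hj, hi, ?_⟩
  rw [← e]
  nth_rewrite 1 [← h]
  simp

/-- The tableau of a permutation, as a ballot word. -/
noncomputable def permWord {n : ℕ} (π : Equiv.Perm (Fin n)) : ℕ → ℕ := growH (permFill π) n

theorem isBallot_permWord {n : ℕ} (π : Equiv.Perm (Fin n)) : IsBallot n (permWord π) where
  support j := by
    rw [permWord, (isGrowth_permFill π).H_ne_zero_iff]
    constructor
    · rintro ⟨_, _, _, hj, _⟩
      exact hj
    · intro hj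
      exact ⟨π.symm ⟨j, hj⟩, Fin.is_lt _, Fin.is_lt _, hj, by simp⟩
  count_le := (isGrowth_permFill π).ballot n

theorem permWord_injective {n : ℕ} {π σ : Equiv.Perm (Fin n)} (hπ : π⁻¹ = π) (hσ : σ⁻¹ = σ)
    (h : permWord π = permWord σ) : π = σ := by
  ext i
  have := ((isGrowth_permFill π).unique (isGrowth_permFill σ) (permFill_symm hπ)
    (permFill_symm hσ) (congrFun h) i.2 (π i).2).1 ⟨i.2, (π i).2, rfl⟩
  obtain ⟨_, _, e⟩ := this
  exact (congrArg Fin.val e).symm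

theorem exists_permWord_eq {n : ℕ} {c : ℕ → ℕ} (hc : IsBallot n c) :
    ∃ π : Equiv.Perm (Fin n), π⁻¹ = π ∧ permWord π = c := by
  obtain ⟨K, W, g⟩ : ∃ K W, IsUngrowth (fun v => c (n - 1 - v)) K W := ⟨_, _, isUngrowth_ungrow _⟩
  have hex : ∀ i : Fin n, ∃ j : Fin n, (K (n - 1 - i) (n - 1 - j) = 1 ∧
      W (n - 1 - i) (n - 1 - j) = 1) ∧ ∀ j' : Fin n, K (n - 1 - i) (n - 1 - j') = 1 →
      W (n - 1 - i) (n - 1 - j') = 1 → j' = j := by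
    intro i
    obtain ⟨v, hv, h1, h2⟩ := g.existsUnique hc (show n - 1 - (i : ℕ) < n by omega)
    refine ⟨⟨n - 1 - v, by omega⟩, ?_, fun j' h3 h4 => ?_⟩
    · simp only
      rwa [show n - 1 - (n - 1 - v) = v by omega]
    · have := h2 _ h3 h4
      ext
      simp only
      omega
  choose f hf hu using hex
  have hinv : Function.Involutive f := by
    intro i
    refine (hu (f i) i ?_ ?_).symm
    · rw [g.symm]; exact (hf i).2
    · rw [← g.symm]; exact (hf i).1
  have hfill : ∀ i j, i < n → j < n → (permFill (hinv.toPerm f) i j ↔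
      K (n - 1 - i) (n - 1 - j) = 1 ∧ W (n - 1 - i) (n - 1 - j) = 1) := by
    intro i j hi hj
    constructor
    · rintro ⟨_, _, h⟩
      have := hf ⟨i, hi⟩
      rw [Function.Involutive.coe_toPerm] at h
      rw [h] at this
      exact this
    · rintro ⟨h1, h2⟩
      exact ⟨hi, hj, (hu ⟨i, hi⟩ ⟨j, hj⟩ h1 h2).symm⟩
  refine ⟨hinv.toPerm f, hinv.symm_eq_self_of_involutive, ?_⟩
  have G := isGrowth_permFill (hinv.toPerm f)
  have key : ∀ i, (i ≤ n → ∀ j < n, growH (permFill (hinv.toPerm f)) i j = K (n - i) (n - 1 - j)) ∧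
      (i < n → ∀ j ≤ n, growV (permFill (hinv.toPerm f) i) (growH (permFill (hinv.toPerm f)) i) j =
        W (n - 1 - i) (n - j)) := by
    have hV : ∀ i < n, (∀ j < n, growH (permFill (hinv.toPerm f)) i j = K (n - i) (n - 1 - j)) →
        ∀ j ≤ n, growV (permFill (hinv.toPerm f) i) (growH (permFill (hinv.toPerm f)) i) j =
        W (n - 1 - i) (n - j) := by
      intro i hi hH j
      induction j with
      | zero =>
        intro _
        rw [G.V_zero, ← g.symm]
        exact (g.eq_zero hc (by omega)).symm
      | succ j ih =>
        intro hj
        have e1 := hH j hj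
        have e2 := ih (by omega)
        have e3 := hfill i j hi hj
        have e4 := g.K_succ (n - 1 - i) (n - 1 - j)
        have e5 := g.W_succ (n - 1 - i) (n - 1 - j)
        rw [show n - 1 - i + 1 = n - i by omega] at e4
        rw [show n - 1 - j + 1 = n - j by omega] at e5
        have c := G.cell i j
        rw [show n - (j + 1) = n - 1 - j by omega]
        by_cases hp : permFill (hinv.toPerm f) i j
        · have := e3.1 hp
          have := G.pt i j hp
          omega
        · rw [e3] at c
          rw [e3] at hp
          split_ifs at e4 e5 <;> omega
    intro i
    induction i with
    | zero =>
      have h0 : ∀ j < n, growH (permFill (hinv.toPerm f)) 0 j = K (n - 0) (n - 1 - j) := by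
        intro j hj
        rw [G.H_zero]
        exact (g.eq_zero hc (by omega)).symm
      exact ⟨fun _ => h0, fun h => hV 0 h h0⟩
    | succ i ih =>
      have h1 : i + 1 ≤ n → ∀ j < n,
          growH (permFill (hinv.toPerm f)) (i + 1) j = K (n - (i + 1)) (n - 1 - j) := by
        intro hi j hj
        have e1 := ih.1 (by omega) j hj
        have e2 := ih.2 (by omega) j hj.le
        have e3 := hfill i j hi hj
        have e4 := g.K_succ (n - 1 - i) (n - 1 - j)
        have e5 := g.W_succ (n - 1 - i) (n - 1 - j)
        rw [show n - 1 - i + 1 = n - i by omega] at e4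
        rw [show n - 1 - j + 1 = n - j by omega] at e5
        have c := G.cell i j
        rw [show n - (i + 1) = n - 1 - i by omega]
        by_cases hp : permFill (hinv.toPerm f) i j
        · have := e3.1 hp
          have := G.pt i j hp
          omega
        · rw [e3] at c
          rw [e3] at hp
          split_ifs at e4 e5 <;> omega
      exact ⟨h1, fun hi => hV (i + 1) hi (h1 hi.le)⟩
  funext j
  by_cases hj : j < n
  · rw [permWord, (key n).1 le_rfl j hj, Nat.sub_self, g.K_zero]
    congr 1
    omega
  · have h1 := mt (hc.support j).1 hj
    have h2 := mt ((isBallot_permWord (hinv.toPerm f)).support j).1 hj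
    omega

/-- The transpose of a ballot word: each letter (the row of a cell of the tableau) is replaced by
the column of the cell. -/
def transposeWord (c : ℕ → ℕ) (j : ℕ) : ℕ :=
  if c j = 0 then 0 else Nat.count (fun x => c x = c j) (j + 1)

theorem count_transposeWord {c : ℕ → ℕ} {B m : ℕ} (hB : ∀ j, c j ≤ B) (hm : m ≠ 0) (j : ℕ) :
    Nat.count (fun x => transposeWord c x = m) j =
      ((Finset.Icc 1 B).filter fun a => m ≤ Nat.count (fun x => c x = a) j).card := by
  induction j with
  | zero => simp [hm]
  | succ j ih =>
    rw [Nat.count_succ, ih]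
    by_cases h : transposeWord c j = m
    · have h0 : c j ≠ 0 := by
        intro h0
        exact hm (by simpa [transposeWord, h0] using h.symm)
      have h1 : Nat.count (fun x => c x = c j) j + 1 = m := by
        simpa [transposeWord, h0, Nat.count_succ] using h
      rw [if_pos h, ← Finset.card_insert_of_notMem (a := c j)]
      · congr 1
        ext a
        simp only [Finset.mem_insert, Finset.mem_filter, Finset.mem_Icc, Nat.count_succ]
        have := hB j
        by_cases e : c j = a
        · subst e
          simp only [if_true, true_or, true_iff]
          omega
        · simp only [e, if_false, add_zero, Ne.symm e, false_or]
      · simp only [Finset.mem_filter, not_and]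
        omega
    · rw [if_neg h, add_zero]
      congr 1
      ext a
      simp only [Finset.mem_filter, Finset.mem_Icc, Nat.count_succ]
      by_cases e : c j = a
      · subst e
        by_cases h0 : c j = 0
        · simp [h0]
        · have h1 : Nat.count (fun x => c x = c j) j + 1 ≠ m := by
            simpa [transposeWord, h0, Nat.count_succ] using h
          simp only [if_true]
          omega
      · simp only [e, if_false, add_zero]

namespace IsBallot

variable {n : ℕ} {c : ℕ → ℕ}

theorem count_antitone (hc : IsBallot n c) (j : ℕ) {a b : ℕ} (ha : a ≠ 0) (hab : a ≤ b) :
    Nat.count (fun x => c x = b) j ≤ Nat.count (fun x => c x = a) j := by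
  induction b, hab using Nat.le_induction with
  | base => rfl
  | succ b hb ih => exact (hc.count_le j b (by omega)).trans ih

theorem transpose (hc : IsBallot n c) : IsBallot n (transposeWord c) where
  support j := by
    rw [← hc.support, transposeWord]
    split_ifs with h
    · simp [h]
    · simp [h, Nat.count_succ]
  count_le j a ha := by
    obtain ⟨B, hB⟩ := hc.exists_bound
    rw [count_transposeWord hB ha, count_transposeWord hB (Nat.succ_ne_zero a)]
    refine Finset.card_le_card fun b hb => ?_
    simp only [Finset.mem_filter] at hb ⊢
    exact ⟨hb.1, by omega⟩

theorem transpose_transpose (hc : IsBallot n c) : transposeWord (transposeWord c) = c := by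
  funext j
  by_cases h : c j = 0
  · simp [transposeWord, h]
  obtain ⟨B, hB⟩ := hc.exists_bound
  have h1 : transposeWord c j = Nat.count (fun x => c x = c j) (j + 1) := by
    simp [transposeWord, h]
  have h2 : transposeWord c j ≠ 0 := by simp [h1, Nat.count_succ]
  rw [transposeWord, if_neg h2, count_transposeWord hB h2]
  have h3 : ((Finset.Icc 1 B).filter fun a =>
      transposeWord c j ≤ Nat.count (fun x => c x = a) (j + 1)) = Finset.Icc 1 (c j) := by
    ext a
    simp only [Finset.mem_filter, Finset.mem_Icc, h1]
    have := hB j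
    constructor
    · rintro ⟨⟨h4, h5⟩, h6⟩
      refine ⟨h4, ?_⟩
      by_contra! h7
      have h8 := hc.count_antitone j h h7.le
      rw [Nat.count_succ, Nat.count_succ, if_pos rfl, if_neg h7.ne] at h6
      omega
    · rintro ⟨h4, h5⟩
      exact ⟨⟨h4, by omega⟩, hc.count_antitone _ (by omega) h5⟩
  rw [h3]
  simp

theorem transpose_le (hc : IsBallot n c) (j : ℕ) :
    transposeWord c j ≤ Nat.count (fun x => c x = 1) n := by
  by_cases h : c j = 0
  · simp [transposeWord, h]
  · have h1 := (hc.support j).1 h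
    rw [transposeWord, if_neg h]
    exact (hc.count_antitone _ one_ne_zero (by omega)).trans (Nat.count_monotone _ h1)

theorem ncard_count_eq (n k : ℕ) :
    {c | IsBallot n c ∧ ¬ k + 1 ≤ Nat.count (fun x => c x = 1) n}.ncard =
      {c | IsBallot n c ∧ ¬ ∃ j, k + 1 ≤ c j}.ncard := by
  refine Set.ncard_congr (fun c _ => transposeWord c) ?_ ?_ ?_
  · rintro c ⟨hc, hk⟩
    refine ⟨hc.transpose, ?_⟩
    rintro ⟨j, hj⟩
    exact hk (hj.trans (hc.transpose_le j))
  · rintro c d ⟨hc, -⟩ ⟨hd, -⟩ h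
    rw [← hc.transpose_transpose, h, hd.transpose_transpose]
  · rintro c ⟨hc, hk⟩
    refine ⟨transposeWord c, ⟨hc.transpose, ?_⟩, hc.transpose_transpose⟩
    have hB : ∀ j, c j ≤ k := fun j => by
      by_contra h
      exact hk ⟨j, by omega⟩
    rw [count_transposeWord hB one_ne_zero]
    have := Finset.card_filter_le (Finset.Icc 1 k)
      (fun a => 1 ≤ Nat.count (fun x => c x = a) n)
    simp only [Nat.card_Icc] at this
    omega

end IsBallot

theorem incChain_permFill_iff {n : ℕ} (π : Equiv.Perm (Fin n)) (k : ℕ) :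
    IncChain (permFill π) (k + 1) n n ↔
      ∃ f : Fin (k + 1) → Fin n, StrictMono f ∧ StrictMono (π ∘ f) := by
  constructor
  · rintro ⟨x, y, h1, h2⟩
    have hx : ∀ a : Fin (k + 1), x a < n := fun a => (h1 a a.2).2.1
    have hy : ∀ a : Fin (k + 1), (π ⟨x a, hx a⟩ : ℕ) = y a := fun a => by
      obtain ⟨⟨_, _, e⟩, -⟩ := h1 a a.2
      rw [e]
    refine ⟨fun a => ⟨x a, hx a⟩, ?_, ?_⟩
    · exact Fin.strictMono_iff_lt_succ.2 fun i => (h2 i (by omega)).1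
    · refine Fin.strictMono_iff_lt_succ.2 fun i => Fin.lt_def.2 ?_
      simp only [Function.comp_apply, hy]
      exact (h2 i (by omega)).2
  · rintro ⟨f, h1, h2⟩
    refine ⟨fun m => if h : m < k + 1 then f ⟨m, h⟩ else 0,
      fun m => if h : m < k + 1 then π (f ⟨m, h⟩) else 0, fun m hm => ?_, fun m hm => ?_⟩
    · simp only [hm, dif_pos]
      exact ⟨⟨Fin.is_lt _, Fin.is_lt _, by simp⟩, Fin.is_lt _, Fin.is_lt _⟩
    · have hm' : m < k + 1 := by omega
      have hlt : (⟨m, hm'⟩ : Fin (k + 1)) < ⟨m + 1, hm⟩ := Nat.lt_succ_self m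
      simp only [hm, hm', dif_pos]
      exact ⟨h1 hlt, h2 hlt⟩

theorem decChain_permFill_iff {n : ℕ} (π : Equiv.Perm (Fin n)) (k : ℕ) :
    DecChain (permFill π) (k + 1) ↔
      ∃ f : Fin (k + 1) → Fin n, StrictMono f ∧ StrictAnti (π ∘ f) := by
  constructor
  · rintro ⟨x, y, h1, h2⟩
    have hx : ∀ a : Fin (k + 1), x a < n := fun a => (h1 a a.2).1
    have hy : ∀ a : Fin (k + 1), (π ⟨x a, hx a⟩ : ℕ) = y a := fun a => by
      obtain ⟨_, _, e⟩ := h1 a a.2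
      rw [e]
    refine ⟨fun a => ⟨x a, hx a⟩, ?_, ?_⟩
    · exact Fin.strictMono_iff_lt_succ.2 fun i => (h2 i (by omega)).1
    · refine Fin.strictAnti_iff_succ_lt.2 fun i => Fin.lt_def.2 ?_
      simp only [Function.comp_apply, hy]
      exact (h2 i (by omega)).2
  · rintro ⟨f, h1, h2⟩
    refine ⟨fun m => if h : m < k + 1 then f ⟨m, h⟩ else 0,
      fun m => if h : m < k + 1 then π (f ⟨m, h⟩) else 0, fun m hm => ?_, fun m hm => ?_⟩
    · simp only [hm, dif_pos]
      exact ⟨Fin.is_lt _, Fin.is_lt _, by simp⟩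
    · have hm' : m < k + 1 := by omega
      have hlt : (⟨m, hm'⟩ : Fin (k + 1)) < ⟨m + 1, hm⟩ := Nat.lt_succ_self m
      simp only [hm, hm', dif_pos]
      exact ⟨h1 hlt, h2 hlt⟩

theorem permContains_iff_strictMono {n k : ℕ} (π : Equiv.Perm (Fin n)) (τ : Equiv.Perm (Fin k)) :
    PermContains π τ ↔ ∃ f : Fin k → Fin n, StrictMono f ∧ StrictMono (π ∘ f ∘ τ.symm) := by
  refine exists_congr fun f => and_congr_right fun _ => ⟨fun h a b hab => ?_, fun h a b => ?_⟩
  · exact (h _ _).1 (by simpa using hab)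
  · simpa using (h.lt_iff_lt (a := τ a) (b := τ b)).symm

theorem permContains_p12345_iff {n : ℕ} (π : Equiv.Perm (Fin n)) :
    PermContains π p12345 ↔ 5 ≤ Nat.count (fun x => permWord π x = 1) n := by
  rw [permWord, ← (isGrowth_permFill π).incChain_iff, incChain_permFill_iff,
    permContains_iff_strictMono]
  rfl

theorem permContains_p54321_iff_strictAnti {n : ℕ} (π : Equiv.Perm (Fin n)) :
    PermContains π p54321 ↔ ∃ f : Fin 5 → Fin n, StrictMono f ∧ StrictAnti (π ∘ f) := by
  have h54321 : ∀ a b, p54321 a < p54321 b ↔ b < a := by decide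
  refine exists_congr fun f => and_congr_right fun _ => ?_
  simp only [h54321]
  exact ⟨fun h a b hab => (h b a).1 hab, fun h a b => h.lt_iff_gt.symm⟩

theorem permContains_p54321_iff {n : ℕ} (π : Equiv.Perm (Fin n)) :
    PermContains π p54321 ↔ ∃ j, 5 ≤ permWord π j := by
  rw [permWord, ← (isGrowth_permFill π).decChain_iff (fun _ _ h => h.1) (by omega),
    decChain_permFill_iff, permContains_p54321_iff_strictAnti]

theorem ncard_permWord {n : ℕ} (Q : (ℕ → ℕ) → Prop) :
    {π : Equiv.Perm (Fin n) | π⁻¹ = π ∧ ¬ Q (permWord π)}.ncard =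
      {c | IsBallot n c ∧ ¬ Q c}.ncard := by
  refine Set.ncard_congr (fun π _ => permWord π) (fun π h => ⟨isBallot_permWord π, h.2⟩)
    (fun π σ h h' => permWord_injective h.1 h'.1) ?_
  rintro c ⟨hc, hQ⟩
  obtain ⟨π, h, rfl⟩ := exists_permWord_eq hc
  exact ⟨π, ⟨h, hQ⟩, rfl⟩

/-- As many involutions avoid `12345` as avoid `54321`. -/
theorem iAvoidCount_p12345 (n : ℕ) : IAvoidCount n p12345 = IAvoidCount n p54321 := by
  simp only [IAvoidCount, permContains_p12345_iff, permContains_p54321_iff]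
  rw [ncard_permWord fun c => 5 ≤ Nat.count (fun x => c x = 1) n,
    ncard_permWord fun c => ∃ j, 5 ≤ c j]
  exact IsBallot.ncard_count_eq n 4

/-- The cell `(x, y)` lies to the upper left of a point of `π` on or above the diagonal. -/
def UpperLeft {n : ℕ} (π : Equiv.Perm (Fin n)) (x y : Fin n) : Prop :=
  ∃ a, x < a ∧ a ≤ π a ∧ π a < y

/-- `π` has an increasing pair of points to the upper left of a point on or above the diagonal. -/
def HasUpperInc {n : ℕ} (π : Equiv.Perm (Fin n)) : Prop :=
  ∃ x₁ x₂, x₁ < x₂ ∧ UpperLeft π x₂ (π x₁) ∧ π x₁ < π x₂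

/-- `π` has a decreasing pair of points to the upper left of a point on or above the diagonal. -/
def HasUpperDec {n : ℕ} (π : Equiv.Perm (Fin n)) : Prop :=
  ∃ x₁ x₂, x₁ < x₂ ∧ UpperLeft π x₂ (π x₂) ∧ π x₂ < π x₁

/-- `π` and `σ` agree outside the region of cells to the upper left of points on or above the
diagonal, and use the same columns inside it. -/
structure UpperEquiv {n : ℕ} (π σ : Equiv.Perm (Fin n)) : Prop where
  lt_iff : ∀ x, x < π x ↔ x < σ x
  region : ∀ x y, UpperLeft π x y ↔ UpperLeft σ x y
  outside : ∀ x y, x ≤ y → ¬ UpperLeft π x y → (π x = y ↔ σ x = y)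

section

variable {n : ℕ} {π σ : Equiv.Perm (Fin n)}

theorem apply_apply_of_inv_eq (h : π⁻¹ = π) (x : Fin n) : π (π x) = x := by
  nth_rewrite 1 [← h]
  simp

theorem permContains_p45312_iff (h : π⁻¹ = π) : PermContains π p45312 ↔ HasUpperInc π := by
  have hh := apply_apply_of_inv_eq h
  constructor
  · rintro ⟨f, hf, hτ⟩
    have h1 : π (f 3) < π (f 4) := (hτ 3 4).1 (by decide)
    have h2 : π (f 4) < π (f 2) := (hτ 4 2).1 (by decide)
    have h3 : π (f 2) < π (f 0) := (hτ 2 0).1 (by decide)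
    have h4 : π (f 0) < π (f 1) := (hτ 0 1).1 (by decide)
    have f1 : f 0 < f 1 := hf (by decide)
    have f2 : f 1 < f 2 := hf (by decide)
    have f3 : f 2 < f 3 := hf (by decide)
    have f4 : f 3 < f 4 := hf (by decide)
    rcases le_total (f 2) (π (f 2)) with hle | hle
    · exact ⟨f 0, f 1, f1, ⟨f 2, f2, hle, h3⟩, h4⟩
    · refine ⟨π (f 3), π (f 4), h1, ⟨π (f 2), h2, ?_, ?_⟩, ?_⟩
      · rwa [hh]
      · rwa [hh, hh]
      · rwa [hh, hh]
  · rintro ⟨x, y, hxy, ⟨c, h1, h2, h3⟩, h4⟩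
    rw [permContains_iff_strictMono]
    refine ⟨![x, y, c, π x, π y], ?_, ?_⟩
    · refine Fin.strictMono_iff_lt_succ.2 fun i => ?_
      fin_cases i
      exacts [hxy, h1, h2.trans_lt h3, h4]
    · refine Fin.strictMono_iff_lt_succ.2 fun i => ?_
      fin_cases i
      · change π (π x) < π (π y)
        rwa [hh, hh]
      · change π (π y) < π c
        rw [hh]
        exact h1.trans_le h2
      exacts [h3, h4]

theorem permContains_p54321_iff_hasUpperDec (h : π⁻¹ = π) :
    PermContains π p54321 ↔ HasUpperDec π := by
  have hh := apply_apply_of_inv_eq h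
  rw [permContains_p54321_iff_strictAnti]
  constructor
  · rintro ⟨f, hf, hτ⟩
    have h1 : π (f 4) < π (f 3) := hτ (by decide)
    have h2 : π (f 3) < π (f 2) := hτ (by decide)
    have h3 : π (f 2) < π (f 1) := hτ (by decide)
    have h4 : π (f 1) < π (f 0) := hτ (by decide)
    have f1 : f 0 < f 1 := hf (by decide)
    have f2 : f 1 < f 2 := hf (by decide)
    have f3 : f 2 < f 3 := hf (by decide)
    have f4 : f 3 < f 4 := hf (by decide)
    rcases le_total (f 2) (π (f 2)) with hle | hle
    · exact ⟨f 0, f 1, f1, ⟨f 2, f2, hle, h3⟩, h4⟩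
    · refine ⟨π (f 4), π (f 3), h1, ⟨π (f 2), h2, ?_, ?_⟩, ?_⟩
      · rwa [hh]
      · rwa [hh, hh]
      · rwa [hh, hh]
  · rintro ⟨x, y, hxy, ⟨c, h1, h2, h3⟩, h4⟩
    refine ⟨![x, y, c, π y, π x], ?_, ?_⟩
    · refine Fin.strictMono_iff_lt_succ.2 fun i => ?_
      fin_cases i
      exacts [hxy, h1, h2.trans_lt h3, h4]
    · refine Fin.strictAnti_iff_succ_lt.2 fun i => ?_
      fin_cases i
      · exact h4
      · exact h3
      · change π (π y) < π c
        rw [hh]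
        exact h1.trans_le h2
      · change π (π x) < π (π y)
        rwa [hh, hh]

theorem UpperEquiv.symm (h : UpperEquiv π σ) : UpperEquiv σ π where
  lt_iff x := (h.lt_iff x).symm
  region x y := (h.region x y).symm
  outside x y hxy hn := (h.outside x y hxy (mt (h.region x y).1 hn)).symm

theorem UpperEquiv.trans {ρ : Equiv.Perm (Fin n)} (h : UpperEquiv π σ) (h' : UpperEquiv σ ρ) :
    UpperEquiv π ρ where
  lt_iff x := (h.lt_iff x).trans (h'.lt_iff x)
  region x y := (h.region x y).trans (h'.region x y)
  outside x y hxy hn :=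
    (h.outside x y hxy hn).trans (h'.outside x y hxy (mt (h.region x y).2 hn))

theorem UpperEquiv.refl (π : Equiv.Perm (Fin n)) : UpperEquiv π π :=
  ⟨fun _ => Iff.rfl, fun _ _ => Iff.rfl, fun _ _ _ _ => Iff.rfl⟩

/-- The first column (from the right) in which two equivalent involutions differ exhibits an
increasing pair in one of them and a decreasing pair in the other. -/
theorem UpperEquiv.hasUpper_of_lt (h : UpperEquiv π σ) (hπ : π⁻¹ = π) (hσ : σ⁻¹ = σ) {x : Fin n}
    (hx : x < π x) (hlt : π x < σ x) (hmax : ∀ w, x < w → w < π w → π w = σ w) :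
    HasUpperInc σ ∧ HasUpperDec π := by
  have hp := apply_apply_of_inv_eq hπ
  have hs := apply_apply_of_inv_eq hσ
  have hU : UpperLeft π x (π x) := by
    by_contra hn
    exact hlt.ne' ((h.outside x _ hx.le hn).1 rfl)
  have hfix : ∀ z, π z = z ↔ σ z = z := fun z =>
    h.outside z z le_rfl fun ⟨a, h1, h2, h3⟩ => absurd (h1.trans_le h2) h3.not_gt
  constructor
  · have h1 : σ (π x) < π x := by
      refine lt_of_le_of_ne (not_lt.1 fun h1 => ?_) fun h1 => ?_
      · rw [← h.lt_iff, hp] at h1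
        exact h1.not_gt hx
      · rw [← hfix, hp] at h1
        exact hx.ne h1
    have h2 : σ (π x) < x := by
      by_contra! h2
      rcases h2.eq_or_lt with h2 | h2
      · have := congrArg σ h2
        rw [hs] at this
        exact hlt.ne' this
      · have h3 := hmax _ h2 (by rwa [h.lt_iff, hs])
        rw [hs] at h3
        exact h2.ne' (π.injective h3)
    exact ⟨σ (π x), x, h2, by rw [hs]; exact (h.region _ _).1 hU, by rwa [hs]⟩
  · have h1 : π (σ x) < σ x := by
      refine lt_of_le_of_ne (not_lt.1 fun h1 => ?_) fun h1 => ?_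
      · rw [h.lt_iff, hs] at h1
        exact h1.not_gt (hx.trans hlt)
      · rw [hfix, hs] at h1
        exact (hx.trans hlt).ne h1
    have h2 : π (σ x) < x := by
      by_contra! h2
      rcases h2.eq_or_lt with h2 | h2
      · have := congrArg π h2
        rw [hp] at this
        exact hlt.ne this
      · have h3 := hmax _ h2 (by rwa [hp])
        rw [hp] at h3
        exact h2.ne (σ.injective h3)
    exact ⟨π (σ x), x, h2, hU, by rwa [hp]⟩

theorem UpperEquiv.hasUpper_of_ne (h : UpperEquiv π σ) (hπ : π⁻¹ = π) (hσ : σ⁻¹ = σ)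
    (hne : π ≠ σ) : (HasUpperInc σ ∧ HasUpperDec π) ∨ (HasUpperInc π ∧ HasUpperDec σ) := by
  have hp := apply_apply_of_inv_eq hπ
  have hs := apply_apply_of_inv_eq hσ
  have hex : {x | x < π x ∧ π x ≠ σ x}.Nonempty := by
    obtain ⟨x, hx⟩ : ∃ x, π x ≠ σ x := by
      by_contra! h'
      exact hne (Equiv.ext h')
    rcases lt_trichotomy x (π x) with h1 | h1 | h1
    · exact ⟨x, h1, hx⟩
    · refine absurd (((h.outside x x le_rfl ?_).1 h1.symm).trans h1) hx.symm
      rintro ⟨a, h2, h3, h4⟩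
      exact absurd (h2.trans_le h3) h4.not_gt
    · refine ⟨π x, by rwa [hp], fun h2 => hx ?_⟩
      rw [hp] at h2
      have := congrArg σ h2
      rw [hs] at this
      exact this.symm
  obtain ⟨x, ⟨hx, hxne⟩, hmax⟩ := Set.exists_max_image _ id (Set.toFinite _) hex
  have hm : ∀ w, x < w → w < π w → π w = σ w := by
    intro w h1 h2
    by_contra h3
    exact (hmax w ⟨h2, h3⟩).not_gt h1
  rcases lt_or_gt_of_ne hxne with h1 | h1
  · exact Or.inl (h.hasUpper_of_lt hπ hσ hx h1 hm)
  · exact Or.inr (h.symm.hasUpper_of_lt hσ hπ ((h.lt_iff x).1 hx) h1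
      fun w h2 h3 => (hm w h2 ((h.lt_iff w).2 h3)).symm)

/-- Exchanging the values at two points to the upper left of a common point. -/
theorem exists_upperEquiv_swap (hπ : π⁻¹ = π) {x y c : Fin n} (hxy : x ≠ y) (hx : x < c)
    (hy : y < c) (hc : c ≤ π c) (hx' : π c < π x) (hy' : π c < π y) :
    ∃ σ : Equiv.Perm (Fin n), σ⁻¹ = σ ∧ UpperEquiv π σ ∧ σ x = π y ∧
      ∀ z, z < π c → z ≠ x → z ≠ y → σ z = π z := by
  have hfwd : ∀ ρ ρ' : Equiv.Perm (Fin n), (∀ z, ρ (ρ z) = z) → π c < ρ x → π c < ρ y →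
      ρ c = π c → (∀ z, z ≠ x → z ≠ y → z ≠ ρ x → z ≠ ρ y → ρ' z = ρ z) →
      ∀ s t, UpperLeft ρ s t → UpperLeft ρ' s t := by
    intro ρ ρ' hρ h1 h2 h3 h4 s t ⟨a, ha, ha', hat⟩
    have hcc : ρ' c = π c := by
      rw [h4 c hx.ne' hy.ne' (hc.trans_lt h1).ne (hc.trans_lt h2).ne, h3]
    by_cases e1 : a = x
    · subst e1
      exact ⟨c, ha.trans hx, by rwa [hcc], by rw [hcc]; exact h1.trans hat⟩
    by_cases e2 : a = y
    · subst e2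
      exact ⟨c, ha.trans hy, by rwa [hcc], by rw [hcc]; exact h2.trans hat⟩
    have e3 : a ≠ ρ x := by
      rintro rfl
      rw [hρ] at ha'
      exact absurd (hx.trans_le hc) (h1.trans_le ha').not_gt
    have e4 : a ≠ ρ y := by
      rintro rfl
      rw [hρ] at ha'
      exact absurd (hy.trans_le hc) (h2.trans_le ha').not_gt
    exact ⟨a, ha, by rwa [h4 a e1 e2 e3 e4], by rwa [h4 a e1 e2 e3 e4]⟩
  have hp := apply_apply_of_inv_eq hπ
  have hxlt : x < π c := hx.trans_le hc
  have hylt : y < π c := hy.trans_le hc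
  set σ := Equiv.swap x y * π * Equiv.swap x y with hσdef
  have hσ : σ⁻¹ = σ := by
    rw [hσdef, mul_inv_rev, mul_inv_rev, Equiv.swap_inv, hπ, mul_assoc]
  have hs := apply_apply_of_inv_eq hσ
  have σx : σ x = π y := by
    simp only [hσdef, Equiv.Perm.mul_apply, Equiv.swap_apply_left]
    exact Equiv.swap_apply_of_ne_of_ne (hxlt.trans hy').ne' (hylt.trans hy').ne'
  have σy : σ y = π x := by
    simp only [hσdef, Equiv.Perm.mul_apply, Equiv.swap_apply_right]
    exact Equiv.swap_apply_of_ne_of_ne (hxlt.trans hx').ne' (hylt.trans hx').ne'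
  have σz : ∀ z, z ≠ x → z ≠ y → z ≠ π x → z ≠ π y → σ z = π z := by
    intro z h1 h2 h3 h4
    simp only [hσdef, Equiv.Perm.mul_apply, Equiv.swap_apply_of_ne_of_ne h1 h2]
    refine Equiv.swap_apply_of_ne_of_ne (fun h => h3 ?_) (fun h => h4 ?_)
    · rw [← h, hp]
    · rw [← h, hp]
  have σc : σ c = π c := σz c hx.ne' hy.ne' (hc.trans_lt hx').ne (hc.trans_lt hy').ne
  have hreg : ∀ s t, UpperLeft π s t ↔ UpperLeft σ s t := fun s t =>
    ⟨hfwd π σ hp hx' hy' rfl σz s t,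
      hfwd σ π hs (by rwa [σx]) (by rwa [σy]) σc
        (fun z h1 h2 h3 h4 => (σz z h1 h2 (by rwa [← σy]) (by rwa [← σx])).symm) s t⟩
  have σπx : σ (π x) = y := by rw [← σy, hs]
  have σπy : σ (π y) = x := by rw [← σx, hs]
  refine ⟨σ, hσ, ⟨fun z => ?_, hreg, fun s t hst hn => ?_⟩, σx, fun z h1 h2 h3 =>
    σz z h2 h3 (h1.trans hx').ne (h1.trans hy').ne⟩
  · by_cases e1 : z = x
    · subst e1
      rw [σx]
      exact iff_of_true (hxlt.trans hx') (hxlt.trans hy')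
    by_cases e2 : z = y
    · subst e2
      rw [σy]
      exact iff_of_true (hylt.trans hy') (hylt.trans hx')
    by_cases e3 : z = π x
    · subst e3
      rw [σπx, hp]
      exact iff_of_false (hxlt.trans hx').not_gt (hylt.trans hx').not_gt
    by_cases e4 : z = π y
    · subst e4
      rw [σπy, hp]
      exact iff_of_false (hylt.trans hy').not_gt (hxlt.trans hy').not_gt
    rw [σz z e1 e2 e3 e4]
  · by_cases e1 : s = x
    · subst e1
      have hle : t ≤ π c := not_lt.1 fun h => hn ⟨c, hx, hc, h⟩
      rw [σx]
      exact iff_of_false (hle.trans_lt hx').ne' (hle.trans_lt hy').ne'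
    by_cases e2 : s = y
    · subst e2
      have hle : t ≤ π c := not_lt.1 fun h => hn ⟨c, hy, hc, h⟩
      rw [σy]
      exact iff_of_false (hle.trans_lt hy').ne' (hle.trans_lt hx').ne'
    by_cases e3 : s = π x
    · subst e3
      rw [σπx, hp]
      exact iff_of_false ((hxlt.trans hx').trans_le hst).ne ((hylt.trans hx').trans_le hst).ne
    by_cases e4 : s = π y
    · subst e4
      rw [σπy, hp]
      exact iff_of_false ((hylt.trans hy').trans_le hst).ne ((hxlt.trans hy').trans_le hst).ne
    rw [σz s e1 e2 e3 e4]

theorem exists_upperEquiv_not_hasUpperDec (hπ : π⁻¹ = π) :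
    ∃ σ : Equiv.Perm (Fin n), (σ⁻¹ = σ ∧ ¬ HasUpperDec σ) ∧ UpperEquiv π σ := by
  obtain ⟨σ, ⟨hσ, he⟩, hmin⟩ := Set.exists_min_image {σ | σ⁻¹ = σ ∧ UpperEquiv π σ}
    (fun σ => toLex (σ : Fin n → Fin n)) (Set.toFinite _) ⟨π, hπ, UpperEquiv.refl π⟩
  refine ⟨σ, ⟨hσ, ?_⟩, he⟩
  rintro ⟨x, y, hxy, ⟨c, h1, h2, h3⟩, h4⟩
  obtain ⟨ρ, hρ, he', hx, hz⟩ :=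
    exists_upperEquiv_swap hσ hxy.ne (hxy.trans h1) h1 h2 (h3.trans h4) h3
  refine (hmin ρ ⟨hρ, he.trans he'⟩).not_gt ⟨x, fun j hj => ?_, ?_⟩
  · exact hz j ((hj.trans (hxy.trans h1)).trans_le h2) hj.ne (hj.trans hxy).ne
  · exact hx.trans_lt h4

theorem exists_upperEquiv_not_hasUpperInc (hπ : π⁻¹ = π) :
    ∃ σ : Equiv.Perm (Fin n), (σ⁻¹ = σ ∧ ¬ HasUpperInc σ) ∧ UpperEquiv π σ := by
  obtain ⟨σ, ⟨hσ, he⟩, hmax⟩ := Set.exists_max_image {σ | σ⁻¹ = σ ∧ UpperEquiv π σ}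
    (fun σ => toLex (σ : Fin n → Fin n)) (Set.toFinite _) ⟨π, hπ, UpperEquiv.refl π⟩
  refine ⟨σ, ⟨hσ, ?_⟩, he⟩
  rintro ⟨x, y, hxy, ⟨c, h1, h2, h3⟩, h4⟩
  obtain ⟨ρ, hρ, he', hx, hz⟩ :=
    exists_upperEquiv_swap hσ hxy.ne (hxy.trans h1) h1 h2 h3 (h3.trans h4)
  refine (hmax ρ ⟨hρ, he.trans he'⟩).not_gt ⟨x, fun j hj => ?_, ?_⟩
  · exact (hz j ((hj.trans (hxy.trans h1)).trans_le h2) hj.ne (hj.trans hxy).ne).symm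
  · exact h4.trans_eq hx.symm

end

/-- As many involutions avoid `54321` as avoid `45312`. -/
theorem iAvoidCount_p54321 (n : ℕ) : IAvoidCount n p54321 = IAvoidCount n p45312 := by
  have h1 : {π : Equiv.Perm (Fin n) | π⁻¹ = π ∧ ¬ PermContains π p54321} =
      {π | π⁻¹ = π ∧ ¬ HasUpperDec π} :=
    Set.ext fun π => and_congr_right fun h => not_congr (permContains_p54321_iff_hasUpperDec h)
  have h2 : {π : Equiv.Perm (Fin n) | π⁻¹ = π ∧ ¬ PermContains π p45312} =
      {π | π⁻¹ = π ∧ ¬ HasUpperInc π} :=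
    Set.ext fun π => and_congr_right fun h => not_congr (permContains_p45312_iff h)
  rw [IAvoidCount, IAvoidCount, h1, h2]
  have hex : ∀ π ∈ {π : Equiv.Perm (Fin n) | π⁻¹ = π ∧ ¬ HasUpperDec π},
      ∃ σ : Equiv.Perm (Fin n), (σ⁻¹ = σ ∧ ¬ HasUpperInc σ) ∧ UpperEquiv π σ :=
    fun π h => exists_upperEquiv_not_hasUpperInc h.1
  choose f hf hfe using hex
  refine Set.ncard_congr f hf (fun π π' h h' he => ?_) (fun σ h => ?_)
  · by_contra hne
    have := ((hfe π h).trans (he ▸ (hfe π' h').symm)).hasUpper_of_ne h.1 h'.1 hne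
    exact this.elim (fun e => h.2 e.2) (fun e => h'.2 e.2)
  · obtain ⟨π, hπ, he⟩ := exists_upperEquiv_not_hasUpperDec h.1
    refine ⟨π, hπ, ?_⟩
    by_contra hne
    have := (he.trans (hfe π hπ)).hasUpper_of_ne h.1 (hf π hπ).1 (Ne.symm hne)
    exact this.elim (fun e => (hf π hπ).2 e.1) (fun e => h.2 e.1)

/-- |I_n(54321)| = |I_n(45312)| for every n ≥ 1; equivalently
|I_n(12345)| = |I_n(45312)|. -/
theorem stmt5 : ∀ n : ℕ, 1 ≤ n →
    IAvoidCount n p54321 = IAvoidCount n p45312 ∧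
    IAvoidCount n p12345 = IAvoidCount n p45312 := by
  intro n _
  rw [iAvoidCount_p12345]
  exact ⟨iAvoidCount_p54321 n, iAvoidCount_p54321 n⟩
end

section
/- For every n ≥ 1, the number of involutions in S_n avoiding the pattern 654321 equals the number of involutions in S_n avoiding the pattern 456123, i.e., |I_n(654321)| = |I_n(456123)|. -/
/-- The pattern 654321 (one-line notation, here zero-based). -/
def p654321 : Equiv.Perm (Fin 6) :=
  ⟨![5, 4, 3, 2, 1, 0], ![5, 4, 3, 2, 1, 0], by decide, by decide⟩

/-- The pattern 456123 (one-line notation, here zero-based). -/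
def p456123 : Equiv.Perm (Fin 6) :=
  ⟨![3, 4, 5, 0, 1, 2], ![3, 4, 5, 0, 1, 2], by decide, by decide⟩

/-- Adding a horizontal strip of size `k`, dually: the value at the two-row shape `(N - m, m)` is
the sum of `g` over all two-row shapes obtained from it by adding a horizontal strip of size `k`.
Shapes are recorded by their size `N` and the length `m` of the second row. -/
def addStrip (k : ℕ) (g : ℕ → ℕ → ℕ) (N m : ℕ) : ℕ :=
  ∑ q ∈ Finset.Ico m (min (m + k) (N - m) + 1), g (N + k) q

/-- Extension by zero of a sequence shifted by one. -/
def shiftSeq (h : ℕ → ℕ) : ℕ → ℕ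
  | 0 => 0
  | q + 1 => h q

/-- Remainder left after commuting the removal of a box with strips of total size `k`. -/
def stripRemainder (k : ℕ) (g : ℕ → ℕ → ℕ) (N m : ℕ) : ℕ :=
  ∑ q ∈ Finset.Ico m (min (m + k + 2) (N - m + 1)), shiftSeq (g (N + k - 1)) q

/-- Sum of `g` over the two-row shapes obtained by removing one box. -/
def removeBox (g : ℕ → ℕ → ℕ) : ℕ → ℕ → ℕ := stripRemainder 0 g

theorem addStrip_zero (g : ℕ → ℕ → ℕ) {N m : ℕ} (h : 2 * m ≤ N) : addStrip 0 g N m = g N m := by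
  have : min (m + 0) (N - m) + 1 = m + 1 := by omega
  rw [addStrip, this]
  simp

theorem addStrip_congr (k : ℕ) {g g' : ℕ → ℕ → ℕ} (h : ∀ N m, 2 * m ≤ N → g N m = g' N m)
    {N m : ℕ} (hm : 2 * m ≤ N) : addStrip k g N m = addStrip k g' N m := by
  refine Finset.sum_congr rfl fun q hq => h _ _ ?_
  simp only [Finset.mem_Ico] at hq
  omega

theorem addStrip_add (k : ℕ) (g g' : ℕ → ℕ → ℕ) :
    addStrip k (g + g') = addStrip k g + addStrip k g' := by
  ext N m
  simp [addStrip, Finset.sum_add_distrib]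

theorem addStrip_nil (k : ℕ) : addStrip k 0 = 0 := by
  ext N m
  simp [addStrip]

theorem addStrip_succ_stripRemainder (j k : ℕ) (g : ℕ → ℕ → ℕ) {N m : ℕ} (hm : 2 * m ≤ N) :
    addStrip (j + 1) (stripRemainder k g) N m =
      addStrip j (addStrip k g) N m + stripRemainder (j + 1 + k) g N m := by
  set H := shiftSeq (g (N + (j + 1) + k - 1)) with hH
  have inner (p : ℕ) (hp : p ∈ Finset.Ico m (min (m + (j + 1)) (N - m) + 1)) :
      stripRemainder k g (N + (j + 1)) p =
        H p + ∑ q ∈ Finset.Ico (p + 1) (min (p + k + 2) (N + (j + 1) - p + 1)), H q := by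
    simp only [Finset.mem_Ico] at hp
    rw [stripRemainder, Finset.sum_eq_sum_Ico_succ_bot (by omega)]
  have inner' (p : ℕ) (hp : p ∈ Finset.Ico m (min (m + j) (N - m) + 1)) :
      addStrip k g (N + j) p =
        ∑ q ∈ Finset.Ico (p + 1) (min (p + k + 2) (N + (j + 1) - p + 1)), H q := by
    simp only [Finset.mem_Ico] at hp
    have e : min (p + k + 2) (N + (j + 1) - p + 1) = min (p + k) (N + j - p) + 1 + 1 := by omega
    rw [e, ← Finset.sum_Ico_add' H _ _ 1, addStrip]
    refine Finset.sum_congr rfl fun q _ => ?_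
    have : N + (j + 1) + k - 1 = N + j + k := by omega
    rw [hH, this]
    rfl
  have eW : stripRemainder (j + 1 + k) g N m =
      ∑ q ∈ Finset.Ico m (min (m + (j + 1 + k) + 2) (N - m + 1)), H q := by
    rw [stripRemainder, hH, Nat.add_assoc N]
  rw [addStrip, Finset.sum_congr rfl inner, addStrip, Finset.sum_congr rfl inner', eW,
    Finset.sum_add_distrib]
  by_cases h : m + (j + 1) ≤ N - m
  · have e1 : min (m + (j + 1)) (N - m) + 1 = m + j + 1 + 1 := by omega
    have e2 : min (m + j) (N - m) + 1 = m + j + 1 := by omega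
    rw [e1, e2, Finset.sum_Ico_succ_top (by omega),
      Finset.sum_Ico_succ_top (b := m + j + 1) (by omega),
      ← Finset.sum_Ico_consecutive H (show m ≤ m + j + 1 by omega)
        (show m + j + 1 ≤ min (m + (j + 1 + k) + 2) (N - m + 1) by omega),
      Finset.sum_eq_sum_Ico_succ_bot
        (show m + j + 1 < min (m + (j + 1 + k) + 2) (N - m + 1) by omega)]
    have e3 : min (m + j + 1 + k + 2) (N + (j + 1) - (m + j + 1) + 1)
      = min (m + (j + 1 + k) + 2) (N - m + 1) := by omega
    rw [e3]
    ring
  · have e1 : min (m + (j + 1)) (N - m) + 1 = N - m + 1 := by omega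
    have e2 : min (m + j) (N - m) + 1 = N - m + 1 := by omega
    have e3 : min (m + (j + 1 + k) + 2) (N - m + 1) = N - m + 1 := by omega
    rw [e1, e2, e3]
    ring

/-- Iterated addition of horizontal strips of the sizes listed in `α`. -/
def addStrips (α : List ℕ) (g : ℕ → ℕ → ℕ) : ℕ → ℕ → ℕ := α.foldr addStrip g

theorem addStrips_append (α β : List ℕ) (g : ℕ → ℕ → ℕ) :
    addStrips (α ++ β) g = addStrips α (addStrips β g) := List.foldr_append

theorem addStrips_add (α : List ℕ) (g g' : ℕ → ℕ → ℕ) :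
    addStrips α (g + g') = addStrips α g + addStrips α g' := by
  induction α with
  | nil => rfl
  | cons a α ih =>
    change addStrip a (addStrips α _) = addStrip a (addStrips α _) + addStrip a (addStrips α _)
    rw [ih, addStrip_add]

theorem addStrips_nil (α : List ℕ) : addStrips α 0 = 0 := by
  induction α with
  | nil => rfl
  | cons a α ih =>
    change addStrip a (addStrips α _) = 0
    rw [ih, addStrip_nil]

/-- Sum over all ways to remove one element from one of the blocks of sizes `α` and to merge all
later blocks. -/
def mergeSum (g : ℕ → ℕ → ℕ) : List ℕ → ℕ → ℕ → ℕ
  | [] => 0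
  | 0 :: α => addStrip 0 (mergeSum g α)
  | (a + 1) :: α => addStrip a (addStrip α.sum g) + addStrip (a + 1) (mergeSum g α)

theorem addStrips_removeBox (α : List ℕ) (g : ℕ → ℕ → ℕ) {N m : ℕ} (hm : 2 * m ≤ N) :
    addStrips α (removeBox g) N m = mergeSum g α N m + stripRemainder α.sum g N m := by
  induction α generalizing N m with
  | nil => simp [addStrips, removeBox, mergeSum]
  | cons a α ih =>
    change addStrip a (addStrips α _) N m = _
    rw [addStrip_congr a (g' := mergeSum g α + stripRemainder α.sum g) (fun _ _ => ih) hm,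
      addStrip_add]
    cases a with
    | zero =>
      simp only [Pi.add_apply, addStrip_zero _ hm, mergeSum, List.sum_cons, zero_add]
    | succ a =>
      simp only [Pi.add_apply, mergeSum, List.sum_cons, addStrip_succ_stripRemainder _ _ _ hm]
      ring

theorem addStrips_removeBox_zero (α : List ℕ) (g : ℕ → ℕ → ℕ) :
    addStrips α (removeBox g) 0 0 = mergeSum g α 0 0 := by
  rw [addStrips_removeBox α g (by simp)]
  simp [stripRemainder, shiftSeq]

/-- The shapes of size `0`. -/
def emptyShape (N _m : ℕ) : ℕ := if N = 0 then 1 else 0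

/-- The number of walks of length `s` from a given two-row shape to the empty one, where every step
stays put, adds a box or removes a box. -/
def walkCount : ℕ → ℕ → ℕ → ℕ
  | 0 => emptyShape
  | s + 1 => walkCount s + addStrip 1 (walkCount s) + removeBox (walkCount s)

theorem addStrips_emptyShape (α : List ℕ) {N m : ℕ} (hm : 2 * m ≤ N) :
    addStrips α emptyShape N m = if N + α.sum = 0 then 1 else 0 := by
  induction α generalizing N m with
  | nil => simp [addStrips, emptyShape]
  | cons a α ih =>
    change addStrip a (addStrips α _) N m = _
    rw [addStrip_congr a (g' := fun N _ => if N + α.sum = 0 then 1 else 0) (fun _ _ => ih) hm,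
      addStrip]
    by_cases h : N + a = 0
    · obtain ⟨rfl, rfl⟩ : N = 0 ∧ a = 0 := by omega
      obtain rfl : m = 0 := by omega
      simp
    · have h' : ¬ N + (a :: α).sum = 0 := by
        rw [List.sum_cons]
        omega
      rw [if_neg h']
      refine Finset.sum_eq_zero fun q _ => ?_
      exact if_neg (by omega)

theorem removeBox_apply (g : ℕ → ℕ → ℕ) {N m : ℕ} (hm : 2 * m ≤ N) :
    removeBox g N m =
      shiftSeq (g (N - 1)) m + if 2 * m + 1 ≤ N then g (N - 1) m else 0 := by
  rw [removeBox, stripRemainder, Finset.sum_eq_sum_Ico_succ_bot (by omega), add_zero]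
  congr 1
  split_ifs with h
  · have : min (m + 0 + 2) (N - m + 1) = m + 1 + 1 := by omega
    simp [this, shiftSeq]
  · refine Finset.sum_eq_zero fun q hq => ?_
    simp only [Finset.mem_Ico] at hq
    omega

theorem addStrip_one_apply (g : ℕ → ℕ → ℕ) {N m : ℕ} (hm : 2 * m ≤ N) :
    addStrip 1 g N m = g (N + 1) m + if 2 * m + 1 ≤ N then g (N + 1) (m + 1) else 0 := by
  rw [addStrip, Finset.sum_eq_sum_Ico_succ_bot (by omega)]
  congr 1
  split_ifs with h
  · have : min (m + 1) (N - m) + 1 = m + 1 + 1 := by omega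
    simp [this]
  · refine Finset.sum_eq_zero fun q hq => ?_
    simp only [Finset.mem_Ico] at hq
    omega

theorem removeBox_zero (g : ℕ → ℕ → ℕ) (N : ℕ) : removeBox g (N + 1) 0 = g N 0 := by
  simp [removeBox_apply, shiftSeq]

theorem removeBox_zero_zero (g : ℕ → ℕ → ℕ) : removeBox g 0 0 = 0 := by
  simp [removeBox_apply, shiftSeq]

theorem addStrip_one_removeBox (g : ℕ → ℕ → ℕ) {N m : ℕ} (hm : 2 * m ≤ N) :
    addStrip 1 (removeBox g) N m =
      removeBox (addStrip 1 g) N m + if m = 0 then g N 0 else 0 := by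
  have h1 : removeBox g (N + 1) m = shiftSeq (g N) m + g N m := by
    rw [removeBox_apply g (by omega), if_pos (by omega), Nat.add_sub_cancel]
  rw [addStrip_one_apply _ hm, removeBox_apply _ hm, h1]
  have h2 : (if 2 * m + 1 ≤ N then removeBox g (N + 1) (m + 1) else 0) =
      if 2 * m + 1 ≤ N then addStrip 1 g (N - 1) m else 0 := by
    split_ifs with h
    · rw [removeBox_apply g (by omega), addStrip_one_apply g (by omega), shiftSeq,
        Nat.add_sub_cancel, Nat.sub_add_cancel (by omega)]
      congr 1
      exact if_congr (by omega) rfl rfl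
    · rfl
  have h3 : shiftSeq (addStrip 1 g (N - 1)) m + (if m = 0 then g N 0 else 0) =
      shiftSeq (g N) m + g N m := by
    cases m with
    | zero => simp [shiftSeq]
    | succ m =>
      rw [shiftSeq, addStrip_one_apply g (by omega), Nat.sub_add_cancel (by omega),
        if_pos (by omega), if_neg (by omega), shiftSeq, add_zero]
  rw [h2]
  omega

theorem addStrips_replicate_one_removeBox (c : ℕ) (g : ℕ → ℕ → ℕ) {N m : ℕ} (hm : 2 * m ≤ N) :
    addStrips (List.replicate c 1) (removeBox g) N m =
      removeBox (addStrips (List.replicate c 1) g) N m +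
        if m = 0 then ∑ i ∈ Finset.range c, addStrips (List.replicate (c - 1 - i) 1) g (N + i) 0
        else 0 := by
  induction c generalizing N m with
  | zero => simp [addStrips]
  | succ c ih =>
    change addStrip 1 (addStrips (List.replicate c 1) _) N m = _
    rw [addStrip_congr 1 (g' := removeBox (addStrips (List.replicate c 1) g) + fun N m =>
      if m = 0 then ∑ i ∈ Finset.range c, addStrips (List.replicate (c - 1 - i) 1) g (N + i) 0
        else 0) (fun _ _ => ih) hm, addStrip_add, Pi.add_apply, Pi.add_apply,
        addStrip_one_removeBox _ hm, add_assoc]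
    congr 1
    split_ifs with h
    · subst h
      have tail : ∑ q ∈ Finset.Ico (0 + 1) (min (0 + 1) (N - 0) + 1),
          (if q = 0 then ∑ i ∈ Finset.range c,
            addStrips (List.replicate (c - 1 - i) 1) g (N + 1 + i) 0 else 0) = 0 := by
        refine Finset.sum_eq_zero fun q hq => if_neg ?_
        simp only [Finset.mem_Ico] at hq
        omega
      rw [addStrip, Finset.sum_eq_sum_Ico_succ_bot (by omega), tail, Finset.sum_range_succ',
        if_pos rfl, add_zero, add_comm]
      congr 1
      refine Finset.sum_congr rfl fun i _ => ?_
      have e1 : c + 1 - 1 - (i + 1) = c - 1 - i := by omega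
      have e2 : N + (i + 1) = N + 1 + i := by omega
      rw [e1, e2]
    · refine Eq.trans (zero_add _) (Finset.sum_eq_zero fun q hq => if_neg ?_)
      simp only [Finset.mem_Ico] at hq
      omega

section Scan

variable {n : ℕ}

open Classical in
/-- The number of permutations of `Fin n` with a given property. -/
noncomputable def permCount (P : Equiv.Perm (Fin n) → Prop) : ℕ :=
  (Finset.univ.filter P).card

theorem permCount_congr {P Q : Equiv.Perm (Fin n) → Prop} (h : ∀ σ, P σ ↔ Q σ) :
    permCount P = permCount Q := by
  rw [show P = Q from funext fun σ => propext (h σ)]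

theorem permCount_eq_zero {P : Equiv.Perm (Fin n) → Prop} (h : ∀ σ, ¬ P σ) : permCount P = 0 := by
  simp [permCount, h]

theorem permCount_split (P Q : Equiv.Perm (Fin n) → Prop) :
    permCount P = permCount (fun σ => P σ ∧ Q σ) + permCount (fun σ => P σ ∧ ¬ Q σ) := by
  classical
  have := Finset.card_filter_add_card_filter_not (s := Finset.univ.filter P) Q
  simp only [Finset.filter_filter] at this
  unfold permCount
  convert this.symm

theorem permCount_mem (P : Equiv.Perm (Fin n) → Prop) (f : Equiv.Perm (Fin n) → Fin n)
    {l : List (Fin n)} (hl : l.Nodup) :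
    permCount (fun σ => P σ ∧ f σ ∈ l) =
      (l.map fun j => permCount fun σ => P σ ∧ f σ = j).sum := by
  induction l with
  | nil => exact permCount_eq_zero (by simp)
  | cons a l ih =>
    rw [List.nodup_cons] at hl
    rw [permCount_split _ (fun σ => f σ = a), List.map_cons, List.sum_cons, ← ih hl.2]
    congr 1
    · exact permCount_congr fun σ => by grind
    · exact permCount_congr fun σ => by grind

/-- `σ` is an involution whose points before `t` are fixed, except for those in `l`, which are
exchanged with points not before `t`. -/
structure IsOpenAt (t : ℕ) (l : List (Fin n)) (σ : Equiv.Perm (Fin n)) : Prop where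
  invol : ∀ i, σ (σ i) = i
  fixed : ∀ i : Fin n, i.val < t → i ∉ l → σ i = i
  le_apply : ∀ i ∈ l, t ≤ (σ i).val

theorem permCount_scan {t : ℕ} (ht : t < n) {l : List (Fin n)} (hl : ∀ i ∈ l, i.val < t)
    (hnd : l.Nodup) (P : Equiv.Perm (Fin n) → Prop) :
    permCount (fun σ => IsOpenAt t l σ ∧ P σ) =
      permCount (fun σ => IsOpenAt (t + 1) l σ ∧ P σ) +
      permCount (fun σ => IsOpenAt (t + 1) (l ++ [⟨t, ht⟩]) σ ∧ P σ) +
      (l.map fun j => permCount fun σ => (IsOpenAt t l σ ∧ P σ) ∧ σ ⟨t, ht⟩ = j).sum := by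
  set τ : Fin n := ⟨t, ht⟩ with hτ
  have hτv : τ.val = t := rfl
  rw [permCount_split _ (fun σ => σ τ ∈ l), permCount_mem _ _ hnd, add_comm,
    permCount_split (fun σ => (IsOpenAt t l σ ∧ P σ) ∧ ¬ σ τ ∈ l) (fun σ => σ τ = τ)]
  congr 2
  · refine permCount_congr fun σ => ⟨?_, ?_⟩
    · rintro ⟨⟨⟨⟨h1, h2, h3⟩, hP⟩, h4⟩, h5⟩
      refine ⟨⟨h1, fun i hi hil => ?_, fun i hi => ?_⟩, hP⟩
      · by_cases h : i = τ
        · rw [h, h5]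
        · exact h2 i (by have : i.val ≠ t := fun h' => h (Fin.ext h'); omega) hil
      · have := h3 i hi
        have h6 : (σ i).val ≠ t := fun h' => by
          have h7 : σ i = τ := Fin.ext h'
          grind
        omega
    · rintro ⟨⟨h1, h2, h3⟩, hP⟩
      have hτl : τ ∉ l := fun h => by have := hl _ h; omega
      have h5 : σ τ = τ := h2 _ (by omega) hτl
      refine ⟨⟨⟨⟨h1, fun i hi hil => h2 i (by omega) hil, fun i hi => ?_⟩, hP⟩, by rwa [h5]⟩, h5⟩
      have := h3 i hi
      omega
  · refine permCount_congr fun σ => ⟨?_, ?_⟩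
    · rintro ⟨⟨⟨⟨h1, h2, h3⟩, hP⟩, h4⟩, h5⟩
      refine ⟨⟨h1, fun i hi hil => ?_, fun i hi => ?_⟩, hP⟩
      · have : i ≠ τ := by grind
        exact h2 i (by have : i.val ≠ t := fun h' => this (Fin.ext h'); omega) (by grind)
      · rw [List.mem_append, List.mem_singleton] at hi
        obtain hi | rfl := hi
        · have := h3 i hi
          have h6 : (σ i).val ≠ t := fun h' => by
            have h7 : σ i = τ := Fin.ext h'
            grind
          omega
        · by_contra hlt
          have h6 : (σ τ).val ≠ t := fun h' => h5 (Fin.ext h')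
          have := h2 (σ τ) (by omega) h4
          grind
    · rintro ⟨⟨h1, h2, h3⟩, hP⟩
      have h5 := h3 τ (by simp)
      refine ⟨⟨⟨⟨h1, fun i hi hil => h2 i (by omega) ?_, fun i hi => ?_⟩, hP⟩, fun h => ?_⟩,
        fun h => ?_⟩
      · rw [List.mem_append, List.mem_singleton]
        rintro (h | rfl)
        · exact hil h
        · omega
      · have := h3 i (by simp [hi])
        omega
      · have := hl _ h
        omega
      · rw [h] at h5
        omega

theorem isOpenAt_mul_swap {t : ℕ} (ht : t < n) {l₁ l₂ : List (Fin n)} {j : Fin n}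
    (hl : ∀ i ∈ l₁ ++ j :: l₂, i.val < t) (hnd : (l₁ ++ j :: l₂).Nodup)
    (σ : Equiv.Perm (Fin n)) :
    IsOpenAt t (l₁ ++ j :: l₂) σ ∧ σ ⟨t, ht⟩ = j ↔
      IsOpenAt (t + 1) (l₁ ++ l₂) (σ * Equiv.swap j ⟨t, ht⟩) := by
  set τ : Fin n := ⟨t, ht⟩ with hτ
  have hτv : τ.val = t := rfl
  have hj : j.val < t := hl j (by simp)
  have hjτ : j ≠ τ := fun h => by rw [h] at hj; omega
  have hne (i : Fin n) (h : i ≠ τ) : i.val ≠ t := fun h' => h (Fin.ext h')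
  have hj₁ : j ∉ l₁ := by grind
  have hj₂ : j ∉ l₂ := by grind
  have sj : (σ * Equiv.swap j τ) j = σ τ := by simp
  have sτ : (σ * Equiv.swap j τ) τ = σ j := by simp
  have so (i : Fin n) (h : i ≠ j) (h' : i ≠ τ) : (σ * Equiv.swap j τ) i = σ i := by
    simp [Equiv.swap_apply_of_ne_of_ne h h']
  constructor
  · rintro ⟨⟨h1, h2, h3⟩, h4⟩
    have h5 : σ j = τ := by rw [← h4, h1]
    refine ⟨fun i => ?_, fun i hi hil => ?_, fun i hi => ?_⟩
    · by_cases hi : i = j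
      · rw [hi, sj, h4, sj, h4]
      by_cases hi' : i = τ
      · rw [hi', sτ, h5, sτ, h5]
      rw [so i hi hi', so _ (by grind) (by grind), h1]
    · by_cases hi : i = j
      · rw [hi, sj, h4]
      by_cases hi' : i = τ
      · rw [hi', sτ, h5]
      have := hne i hi'
      rw [so i hi hi', h2 i (by omega) (by grind)]
    · have hi1 : i ≠ j := by grind
      have hi2 : i ∈ l₁ ++ j :: l₂ := by grind
      have hi3 : i ≠ τ := fun h => by have := hl i hi2; rw [h] at this; omega
      rw [so i hi1 hi3]
      have := h3 i hi2
      have := hne (σ i) (by grind)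
      omega
  · rintro ⟨h1, h2, h3⟩
    have h4 : σ τ = j := by rw [← sj]; exact h2 j (by omega) (by grind)
    have hτl : τ ∉ l₁ ++ l₂ := fun h => by
      have := hl τ (by grind)
      omega
    have h5 : σ j = τ := by rw [← sτ]; exact h2 τ (by omega) hτl
    refine ⟨⟨fun i => ?_, fun i hi hil => ?_, fun i hi => ?_⟩, h4⟩
    · by_cases hi : i = j
      · rw [hi, h5, h4]
      by_cases hi' : i = τ
      · rw [hi', h4, h5]
      have := h1 i
      rwa [so i hi hi', so (σ i) (by grind) (by grind)] at this
    · have hi1 : i ≠ j := by grind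
      have hi3 : i ≠ τ := fun h => by rw [h] at hi; omega
      rw [← so i hi1 hi3]
      exact h2 i (by omega) (by grind)
    · by_cases hij : i = j
      · rw [hij, h5]
      have := hl i hi
      have hi3 : i ≠ τ := fun h => by rw [h] at this; omega
      have := h3 i (by grind)
      rw [so i hij hi3] at this
      omega

theorem permCount_close {t : ℕ} (ht : t < n) {l₁ l₂ : List (Fin n)} {j : Fin n}
    (hl : ∀ i ∈ l₁ ++ j :: l₂, i.val < t) (hnd : (l₁ ++ j :: l₂).Nodup)
    {P P' : Equiv.Perm (Fin n) → Prop}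
    (h : ∀ σ, IsOpenAt t (l₁ ++ j :: l₂) σ → σ ⟨t, ht⟩ = j →
      (P σ ↔ P' (σ * Equiv.swap j ⟨t, ht⟩))) :
    permCount (fun σ => (IsOpenAt t (l₁ ++ j :: l₂) σ ∧ P σ) ∧ σ ⟨t, ht⟩ = j) =
      permCount (fun σ => IsOpenAt (t + 1) (l₁ ++ l₂) σ ∧ P' σ) := by
  have key (σ : Equiv.Perm (Fin n)) :
      (IsOpenAt t (l₁ ++ j :: l₂) σ ∧ P σ) ∧ σ ⟨t, ht⟩ = j ↔
      IsOpenAt (t + 1) (l₁ ++ l₂) (σ * Equiv.swap j ⟨t, ht⟩) ∧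
        P' (σ * Equiv.swap j ⟨t, ht⟩) := by
    rw [← isOpenAt_mul_swap ht hl hnd]
    have := h σ
    tauto
  refine Finset.card_bij' (fun σ _ => σ * Equiv.swap j ⟨t, ht⟩)
    (fun σ _ => σ * Equiv.swap j ⟨t, ht⟩) ?_ ?_ ?_ ?_
  · intro σ hσ
    simpa [key] using hσ
  · intro σ hσ
    simp only [Finset.mem_filter, Finset.mem_univ, true_and] at hσ ⊢
    rwa [key, mul_assoc, Equiv.swap_mul_self, mul_one]
  · intro σ _
    simp [mul_assoc]
  · intro σ _
    simp [mul_assoc]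

theorem permCount_end {l : List (Fin n)} {P : Equiv.Perm (Fin n) → Prop} (hP : l = [] → P 1) :
    permCount (fun σ => IsOpenAt n l σ ∧ P σ) = if l.length = 0 then 1 else 0 := by
  cases l with
  | nil =>
    have (σ : Equiv.Perm (Fin n)) : IsOpenAt n [] σ ∧ P σ ↔ σ = 1 := by
      constructor
      · rintro ⟨h, -⟩
        exact Equiv.ext fun i => h.fixed i i.2 (by simp)
      · rintro rfl
        exact ⟨⟨by simp, by simp, by simp⟩, hP rfl⟩
    rw [permCount_congr this]
    exact Finset.card_eq_one.2 ⟨1, by ext; simp⟩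
  | cons a l =>
    rw [permCount_eq_zero fun σ h => ?_]
    · simp
    · have := h.1.le_apply a (by simp)
      omega

end Scan

section Crossing

variable {n : ℕ}

theorem List.Pairwise.rel_of_lt {α : Type*} [Preorder α] {R : α → α → Prop} {l : List α}
    (h : l.Pairwise R) (hs : l.Pairwise (· < ·)) {x y : α} (hx : x ∈ l) (hy : y ∈ l)
    (hxy : x < y) : R x y := by
  induction l with
  | nil => simp at hx
  | cons a l ih =>
    rw [List.pairwise_cons] at h hs
    rw [List.mem_cons] at hx hy
    obtain rfl | hx := hx
    · obtain rfl | hy := hy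
      · exact absurd hxy (lt_irrefl _)
      · exact h.1 y hy
    · obtain rfl | hy := hy
      · exact absurd hxy (hs.1 x hx).asymm
      · exact ih h.2 hs.2 hx hy

/-- The involution `σ` has no three mutually crossing arcs. -/
def NoThreeCrossing (σ : Equiv.Perm (Fin n)) : Prop :=
  ∀ i j k, i < j → j < k → k < σ i → σ i < σ j → ¬ σ j < σ k

/-- `σ` is decreasing on each of the lists in `B`. -/
def DecreasingOn (B : List (List (Fin n))) (σ : Equiv.Perm (Fin n)) : Prop :=
  ∀ b ∈ B, b.Pairwise fun x y => σ y < σ x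

/-- How the exchange of `j` and `τ` alters an involution with `σ τ = j`. -/
theorem mul_swap_apply {σ : Equiv.Perm (Fin n)} (hσ : ∀ i, σ (σ i) = i) {j τ : Fin n}
    (h : σ τ = j) (i : Fin n) :
    (σ * Equiv.swap j τ) i = if i = j then j else if i = τ then τ else σ i := by
  have := hσ τ
  rw [Equiv.Perm.mul_apply, Equiv.swap_apply_def]
  split_ifs <;> grind

theorem mem_of_lt_of_ne {t : ℕ} {l : List (Fin n)} {σ : Equiv.Perm (Fin n)}
    (h : IsOpenAt t l σ) {i : Fin n} (hi : i.val < t) (hne : σ i ≠ i) : i ∈ l := by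
  by_contra hil
  exact hne (h.fixed i hi hil)

theorem crossing_close_iff {t : ℕ} (ht : t < n) {B₁ B₂ : List (List (Fin n))} {b : List (Fin n)}
    {j : Fin n} (hs : (B₁.flatten ++ b ++ j :: B₂.flatten).Pairwise (· < ·))
    (hl : ∀ i ∈ B₁.flatten ++ b ++ j :: B₂.flatten, i.val < t) {σ : Equiv.Perm (Fin n)}
    (hσ : IsOpenAt t (B₁.flatten ++ b ++ j :: B₂.flatten) σ) (hj : σ ⟨t, ht⟩ = j) :
    NoThreeCrossing σ ∧ DecreasingOn (B₁ ++ (b ++ [j]) :: B₂) σ ↔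
      NoThreeCrossing (σ * Equiv.swap j ⟨t, ht⟩) ∧
        DecreasingOn (B₁ ++ [b, B₂.flatten]) (σ * Equiv.swap j ⟨t, ht⟩) := by
  set τ : Fin n := ⟨t, ht⟩ with hτ
  have hτv : τ.val = t := rfl
  have app := mul_swap_apply hσ.invol hj
  set σ' := σ * Equiv.swap j τ with hσ'
  have hjτ : σ j = τ := by rw [← hj, hσ.invol]
  have hjt : j < τ := hl j (by simp)
  have hlt : ∀ i ∈ B₁.flatten ++ b ++ j :: B₂.flatten, i < τ := hl
  have hle : ∀ i ∈ B₁.flatten ++ b ++ j :: B₂.flatten, τ ≤ σ i := hσ.le_apply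
  have hmem (i : Fin n) (h : i < τ) (h' : σ i ≠ i) : i ∈ B₁.flatten ++ b ++ j :: B₂.flatten :=
    mem_of_lt_of_ne hσ h h'
  have same (i : Fin n) (h : i ∈ B₁.flatten ++ b ++ B₂.flatten) : σ' i = σ i := by
    rw [app, if_neg, if_neg]
    · rintro rfl
      exact absurd (hlt τ (by grind)) (lt_irrefl _)
    · rintro rfl
      have := hs.nodup
      grind
  have arc (i : Fin n) (h : i < σ' i) : σ' i = σ i ∧ i ≠ j ∧ i ≠ τ := by
    rw [app] at h ⊢
    grind
  have hpair : (b ++ [j]).Pairwise (· < ·) := by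
    refine hs.sublist ?_
    simp
  constructor
  · rintro ⟨hC, hD⟩
    refine ⟨fun p q r hpq hqr hrp hpq' hqr' => ?_, fun c hc => ?_⟩
    · have h1 := arc p (by order)
      have h2 := arc q (by order)
      have h3 := arc r (by order)
      rw [h1.1] at hrp hpq'
      rw [h2.1] at hpq' hqr'
      rw [h3.1] at hqr'
      exact hC p q r hpq hqr hrp hpq' hqr'
    · have congr_on (c : List (Fin n)) (hc : ∀ x ∈ c, x ∈ B₁.flatten ++ b ++ B₂.flatten)
          (h : c.Pairwise fun x y => σ y < σ x) : c.Pairwise fun x y => σ' y < σ' x := by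
        refine h.imp_of_mem fun {x y} hx hy hxy => ?_
        rwa [same x (hc x hx), same y (hc y hy)]
      simp only [List.mem_append, List.mem_cons, List.not_mem_nil, or_false] at hc
      obtain hc | rfl | rfl := hc
      · exact congr_on c (fun x hx => by simp; grind) (hD c (by simp [hc]))
      · refine congr_on c (fun x hx => by simp [hx]) ?_
        exact (hD (c ++ [j]) (by simp)).sublist (by simp)
      · refine congr_on _ (fun x hx => by simp at hx ⊢; tauto) ?_
        have hs2 : (j :: B₂.flatten).Pairwise (· < ·) := hs.sublist (by simp)
        rw [List.pairwise_cons] at hs2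
        refine hs2.2.imp_of_mem fun {x y} hx hy hxy => ?_
        by_contra hcon
        have hne : σ x ≠ σ y := fun h => hxy.ne (σ.injective h)
        have hx' : σ x ≠ τ := fun h => (hs2.1 x hx).ne' (σ.injective (h.trans hjτ.symm))
        have := hle x (by simp at hx ⊢; tauto)
        have := hlt y (by simp at hy ⊢; tauto)
        exact hC j x y (hs2.1 x hx) hxy (by rw [hjτ]; order) (by rw [hjτ]; order) (by order)
  · rintro ⟨hC, hD⟩
    refine ⟨fun p q r hpq hqr hrp hpq' hqr' => ?_, fun c hc => ?_⟩
    · have hτp (h : p = τ) : False := by subst h; rw [hj] at hrp; order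
      have hτq (h : q = τ) : False := by subst h; rw [hj] at hpq'; order
      have hτr (h : r = τ) : False := by subst h; rw [hj] at hqr'; order
      have hjq (h : q = j) : False := by
        rw [h, hjτ] at hpq'
        have := hle p (hmem p (by order) (by order))
        order
      have hjr (h : r = j) : False := by
        rw [h, hjτ] at hqr'
        have := hle p (hmem p (by order) (by order))
        order
      have sq : σ' q = σ q := by rw [app, if_neg hjq, if_neg hτq]
      have sr : σ' r = σ r := by rw [app, if_neg hjr, if_neg hτr]
      by_cases hpj : p = j
      · have hs2 := (List.pairwise_append.1 hs).2
        rw [hpj, hjτ] at hrp hpq'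
        have hq2 : q ∈ B₂.flatten := by
          have := hmem q (by order) (by order)
          grind
        have hr2 : r ∈ B₂.flatten := by
          have := hmem r (by order) (by order)
          grind
        have := (hD B₂.flatten (by simp)).rel_of_lt (List.pairwise_cons.1 hs2.1).2 hq2 hr2 hqr
        rw [sq, sr] at this
        order
      · have sp : σ' p = σ p := by rw [app, if_neg hpj, if_neg hτp]
        rw [← sp] at hrp hpq'
        rw [← sq] at hpq' hqr'
        rw [← sr] at hqr'
        exact hC p q r hpq hqr hrp hpq' hqr'
    · have congr_on (c : List (Fin n)) (hc : ∀ x ∈ c, x ∈ B₁.flatten ++ b ++ B₂.flatten)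
          (h : c.Pairwise fun x y => σ' y < σ' x) : c.Pairwise fun x y => σ y < σ x := by
        refine h.imp_of_mem fun {x y} hx hy hxy => ?_
        rwa [← same x (hc x hx), ← same y (hc y hy)]
      simp only [List.mem_append, List.mem_cons] at hc
      obtain hc | rfl | hc := hc
      · exact congr_on c (fun x hx => by simp; grind) (hD c (by simp [hc]))
      · rw [List.pairwise_append]
        refine ⟨congr_on b (fun x hx => by simp [hx]) (hD b (by simp)), by simp, ?_⟩
        intro x hx y hy
        rw [List.mem_singleton] at hy
        have hxj : x ≠ j := by
          have := (List.pairwise_append.1 hpair).2.2 x hx j (by simp)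
          order
        have := hle x (by simp [hx])
        have hx' : σ x ≠ τ := fun h => hxj (σ.injective (h.trans hjτ.symm))
        rw [hy, hjτ]
        order
      · refine congr_on c (fun x hx => by simp; grind) ?_
        exact (hD B₂.flatten (by simp)).sublist (List.sublist_flatten_of_mem hc)

theorem crossing_close_sum {t : ℕ} (ht : t < n) (g : ℕ → ℕ → ℕ)
    (ih : ∀ B : List (List (Fin n)), B.flatten.Pairwise (· < ·) → (∀ i ∈ B.flatten, i.val < t + 1) →
      permCount (fun σ => IsOpenAt (t + 1) B.flatten σ ∧ NoThreeCrossing σ ∧ DecreasingOn B σ) =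
        addStrips (B.map List.length) g 0 0)
    (B₁ B₂ : List (List (Fin n))) (hs : (B₁ ++ B₂).flatten.Pairwise (· < ·))
    (hl : ∀ i ∈ (B₁ ++ B₂).flatten, i.val < t) :
    (B₂.flatten.map fun j => permCount fun σ =>
      (IsOpenAt t (B₁ ++ B₂).flatten σ ∧ NoThreeCrossing σ ∧ DecreasingOn (B₁ ++ B₂) σ) ∧
        σ ⟨t, ht⟩ = j).sum =
      addStrips (B₁.map List.length) (mergeSum g (B₂.map List.length)) 0 0 := by
  induction B₂ generalizing B₁ with
  | nil => simp [mergeSum, addStrips_nil]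
  | cons b B₂ ih₂ =>
    have e : B₁ ++ b :: B₂ = (B₁ ++ [b]) ++ B₂ := by simp
    have ih₂' := ih₂ (B₁ ++ [b]) (by rwa [← e]) (by rwa [← e])
    rw [← e] at ih₂'
    rw [List.flatten_cons, List.map_append, List.sum_append, ih₂', List.map_append,
      addStrips_append]
    obtain rfl | ⟨b, j, rfl⟩ := b.eq_nil_or_concat'
    · simp only [List.map_nil, List.sum_nil, zero_add]
      rfl
    · have ef : (B₁ ++ (b ++ [j]) :: B₂).flatten = B₁.flatten ++ b ++ j :: B₂.flatten := by simp
      have ef' : (B₁ ++ [b, B₂.flatten]).flatten = B₁.flatten ++ b ++ B₂.flatten := by simp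
      have hs' := ef ▸ hs
      have hl' := ef ▸ hl
      have zero (x : Fin n) (hx : x ∈ b) : permCount (fun σ =>
          (IsOpenAt t (B₁ ++ (b ++ [j]) :: B₂).flatten σ ∧ NoThreeCrossing σ ∧
            DecreasingOn (B₁ ++ (b ++ [j]) :: B₂) σ) ∧ σ ⟨t, ht⟩ = x) = 0 := by
        refine permCount_eq_zero fun σ hσ => ?_
        obtain ⟨⟨h1, -, h2⟩, h3⟩ := hσ
        have h4 : σ j < σ x :=
          (List.pairwise_append.1 (h2 (b ++ [j]) (by simp))).2.2 x hx j (by simp)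
        have h5 := h1.le_apply j (by simp)
        rw [← h3, h1.invol] at h4
        exact absurd h4 (not_lt.2 h5)
      have hz : (b.map fun x => permCount (fun σ =>
          (IsOpenAt t (B₁ ++ (b ++ [j]) :: B₂).flatten σ ∧ NoThreeCrossing σ ∧
            DecreasingOn (B₁ ++ (b ++ [j]) :: B₂) σ) ∧ σ ⟨t, ht⟩ = x)).sum = 0 := by
        rw [List.map_congr_left zero]
        simp
      rw [List.map_append, List.sum_append, hz, zero_add, List.map_singleton, List.sum_singleton]
      have step := permCount_close ht (l₁ := B₁.flatten ++ b) (l₂ := B₂.flatten) hl' hs'.nodup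
        (P := fun σ => NoThreeCrossing σ ∧ DecreasingOn (B₁ ++ (b ++ [j]) :: B₂) σ)
        (P' := fun σ => NoThreeCrossing σ ∧ DecreasingOn (B₁ ++ [b, B₂.flatten]) σ)
        (fun σ h h' => crossing_close_iff ht hs' hl' h h')
      rw [ef, step, ← ef', ih _ ?_ ?_]
      · simp only [List.map_append, List.map_cons, List.map_nil, List.length_append,
          List.length_singleton, List.length_flatten, mergeSum, addStrips_add, Pi.add_apply,
          addStrips_append]
        rfl
      · rw [ef']
        exact hs'.sublist (by simp)
      · rw [ef']
        intro i hi
        have := hl' i (by grind)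
        omega

theorem permCount_crossing (s t : ℕ) (hst : t + s = n) (B : List (List (Fin n)))
    (hs : B.flatten.Pairwise (· < ·)) (hl : ∀ i ∈ B.flatten, i.val < t) :
    permCount (fun σ => IsOpenAt t B.flatten σ ∧ NoThreeCrossing σ ∧ DecreasingOn B σ) =
      addStrips (B.map List.length) (walkCount s) 0 0 := by
  induction s generalizing t B with
  | zero =>
    obtain rfl : t = n := hst
    rw [walkCount, addStrips_emptyShape _ (by simp), zero_add, ← List.length_flatten]
    refine permCount_end fun h => ⟨fun i j k hij hjk hki => ?_, fun b hb => ?_⟩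
    · exact absurd (hij.trans hjk) hki.asymm
    · rw [List.flatten_eq_nil_iff.1 h b hb]
      exact List.Pairwise.nil
  | succ s ih =>
    have ht : t < n := by omega
    have ih' := ih (t + 1) (by omega)
    rw [permCount_scan ht hl hs.nodup, walkCount, addStrips_add, addStrips_add, Pi.add_apply,
      Pi.add_apply, Pi.add_apply, Pi.add_apply, addStrips_removeBox_zero]
    congr 1
    · congr 1
      · exact ih' B hs fun i hi => by have := hl i hi; omega
      · have e : B.flatten ++ [(⟨t, ht⟩ : Fin n)] = (B ++ [[(⟨t, ht⟩ : Fin n)]]).flatten := by simp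
        have := ih' (B ++ [[⟨t, ht⟩]]) ?_ ?_
        · rw [List.map_append, addStrips_append] at this
          rw [e]
          refine Eq.trans (permCount_congr fun σ => ?_) this
          simp [DecreasingOn, or_imp, forall_and]
        · rw [← e, List.pairwise_append]
          refine ⟨hs, by simp, fun x hx y hy => ?_⟩
          rw [List.mem_singleton] at hy
          rw [hy]
          exact hl x hx
        · rw [← e]
          intro i hi
          rw [List.mem_append, List.mem_singleton] at hi
          obtain hi | rfl := hi
          · have := hl i hi
            omega
          · simp
    · exact crossing_close_sum ht (walkCount s) ih' [] B hs hl

end Crossing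

section Nesting

variable {n : ℕ}

/-- The involution `σ` has no three mutually nesting arcs. -/
def NoThreeNesting (σ : Equiv.Perm (Fin n)) : Prop :=
  ∀ i j k, i < j → j < k → k < σ k → σ k < σ j → ¬ σ j < σ i

/-- `σ` is increasing on the list `l`. -/
def IncreasingOn (l : List (Fin n)) (σ : Equiv.Perm (Fin n)) : Prop :=
  l.Pairwise fun x y => σ x < σ y

theorem mul_swap_apply_of_mem {t : ℕ} (ht : t < n) {l r : List (Fin n)} {j : Fin n}
    (hs : (l ++ j :: r).Pairwise (· < ·)) (hl : ∀ i ∈ l ++ j :: r, i.val < t)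
    (σ : Equiv.Perm (Fin n)) {i : Fin n} (h : i ∈ l ++ r) :
    (σ * Equiv.swap j ⟨t, ht⟩) i = σ i := by
  rw [Equiv.Perm.mul_apply, Equiv.swap_apply_of_ne_of_ne]
  · rintro rfl
    have := hs.nodup
    grind
  · rintro rfl
    exact absurd (hl ⟨t, ht⟩ (by grind)) (lt_irrefl t)

theorem IncreasingOn.congr {l : List (Fin n)} {σ σ' : Equiv.Perm (Fin n)}
    (h : ∀ i ∈ l, σ' i = σ i) : IncreasingOn l σ' ↔ IncreasingOn l σ := by
  refine List.Pairwise.iff_of_mem fun {x y} hx hy => ?_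
  rw [h x hx, h y hy]

theorem noThreeNesting_close_iff {t : ℕ} (ht : t < n) {l r : List (Fin n)} {j : Fin n}
    (hs : (l ++ j :: r).Pairwise (· < ·)) (hl : ∀ i ∈ l ++ j :: r, i.val < t)
    {σ : Equiv.Perm (Fin n)} (hσ : IsOpenAt t (l ++ j :: r) σ) (hj : σ ⟨t, ht⟩ = j) :
    NoThreeNesting σ ↔ NoThreeNesting (σ * Equiv.swap j ⟨t, ht⟩) ∧ IncreasingOn l σ := by
  set τ : Fin n := ⟨t, ht⟩ with hτ
  have app := mul_swap_apply hσ.invol hj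
  set σ' := σ * Equiv.swap j τ with hσ'
  have hjτ : σ j = τ := by rw [← hj, hσ.invol]
  have hjt : j < τ := hl j (by simp)
  have hlt : ∀ i ∈ l ++ j :: r, i < τ := hl
  have hle : ∀ i ∈ l ++ j :: r, τ ≤ σ i := hσ.le_apply
  have hmem (i : Fin n) (h : i < τ) (h' : σ i ≠ i) : i ∈ l ++ j :: r :=
    mem_of_lt_of_ne hσ h h'
  have hs2 := List.pairwise_append.1 hs
  have hlj (i : Fin n) (h : i ∈ l) : i < j := hs2.2.2 i h j (by simp)
  constructor
  · intro hN
    refine ⟨fun p q r hpq hqr hr hrq hqp => ?_, ?_⟩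
    · have arc (i : Fin n) (h : i < σ' i) : σ' i = σ i := by
        rw [app] at h ⊢
        grind
      have h1 := arc p (by order)
      have h2 := arc q (by order)
      have h3 := arc r hr
      rw [h3] at hr hrq
      rw [h2] at hrq hqp
      rw [h1] at hqp
      exact hN p q r hpq hqr hr hrq hqp
    · refine hs2.1.imp_of_mem fun {x y} hx hy hxy => ?_
      by_contra hcon
      have hne : σ x ≠ σ y := fun h => hxy.ne (σ.injective h)
      have hyj := hlj y hy
      have hy' : σ y ≠ τ := fun h => hyj.ne (σ.injective (h.trans hjτ.symm))
      have := hle y (by simp [hy])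
      exact hN x y j hxy hyj (by order) (by order) (by order)
  · rintro ⟨hN, hI⟩ p q r hpq hqr hr hrq hqp
    have hpτ (h : p = τ) : False := by subst h; rw [hj] at hqp; order
    have hqτ (h : q = τ) : False := by subst h; rw [hj] at hrq; order
    have hrτ (h : r = τ) : False := by subst h; rw [hj] at hr; order
    have hpj (h : p = j) : False := by
      rw [h, hjτ] at hqp
      have := hle q (hmem q (by order) (by order))
      order
    have hqj (h : q = j) : False := by
      rw [h, hjτ] at hrq
      have := hle r (hmem r (by order) (by order))
      order
    by_cases hrj : r = j
    · rw [hrj, hjτ] at hrq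
      have hr2 := (List.pairwise_cons.1 hs2.2.1).1
      have hp : p ∈ l := by
        have := hmem p (by order) (by order)
        grind
      have hq : q ∈ l := by
        have := hmem q (by order) (by order)
        grind
      have := hI.rel_of_lt hs2.1 hp hq hpq
      order
    · have sp : σ' p = σ p := by rw [app, if_neg hpj, if_neg hpτ]
      have sq : σ' q = σ q := by rw [app, if_neg hqj, if_neg hqτ]
      have sr : σ' r = σ r := by rw [app, if_neg hrj, if_neg hrτ]
      rw [← sr] at hr hrq
      rw [← sq] at hrq hqp
      rw [← sp] at hqp
      exact hN p q r hpq hqr hr hrq hqp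

theorem nesting_close_sum_right {t : ℕ} (ht : t < n) (g : ℕ → ℕ → ℕ)
    (ih : ∀ l r : List (Fin n), (l ++ r).Pairwise (· < ·) → (∀ i ∈ l ++ r, i.val < t + 1) →
      permCount (fun σ => IsOpenAt (t + 1) (l ++ r) σ ∧ NoThreeNesting σ ∧ IncreasingOn l σ) =
        addStrips (List.replicate r.length 1) g l.length 0)
    (l p r : List (Fin n)) (hs : (l ++ p ++ r).Pairwise (· < ·))
    (hl : ∀ i ∈ l ++ p ++ r, i.val < t) :
    (r.map fun j => permCount fun σ =>
      (IsOpenAt t (l ++ p ++ r) σ ∧ NoThreeNesting σ ∧ IncreasingOn l σ) ∧ σ ⟨t, ht⟩ = j).sum =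
      ∑ i ∈ Finset.range r.length,
        addStrips (List.replicate (r.length - 1 - i) 1) g (l.length + p.length + i) 0 := by
  induction r generalizing p with
  | nil => simp
  | cons j r ih₂ =>
    have e : l ++ p ++ j :: r = l ++ (p ++ [j]) ++ r := by simp
    have ih₂' := ih₂ (p ++ [j]) (by rwa [← e]) (by rwa [← e])
    rw [← e] at ih₂'
    rw [List.map_cons, List.sum_cons, ih₂', List.length_cons, Finset.sum_range_succ', add_comm]
    congr 1
    · refine Finset.sum_congr rfl fun i _ => ?_
      have e1 : r.length + 1 - 1 - (i + 1) = r.length - 1 - i := by omega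
      have e2 : l.length + (p ++ [j]).length + i = l.length + p.length + (i + 1) := by
        rw [List.length_append, List.length_singleton]
        omega
      rw [e1, e2]
    · have step := permCount_close ht hl hs.nodup
        (P := fun σ => NoThreeNesting σ ∧ IncreasingOn l σ)
        (P' := fun σ => NoThreeNesting σ ∧ IncreasingOn (l ++ p) σ) fun σ h h' => by
          rw [noThreeNesting_close_iff ht hs hl h h', IncreasingOn.congr (l := l ++ p)
            fun i hi => mul_swap_apply_of_mem ht hs hl σ (List.mem_append_left r hi)]
          have : IncreasingOn (l ++ p) σ → IncreasingOn l σ := fun h =>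
            h.sublist (List.sublist_append_left l p)
          tauto
      rw [step, ih]
      · simp
      · exact hs.sublist (by simp)
      · intro i hi
        have := hl i (by grind)
        omega

theorem nesting_close_sum_left {t : ℕ} (ht : t < n) (g : ℕ → ℕ → ℕ)
    (ih : ∀ l r : List (Fin n), (l ++ r).Pairwise (· < ·) → (∀ i ∈ l ++ r, i.val < t + 1) →
      permCount (fun σ => IsOpenAt (t + 1) (l ++ r) σ ∧ NoThreeNesting σ ∧ IncreasingOn l σ) =
        addStrips (List.replicate r.length 1) g l.length 0)
    (l r : List (Fin n)) (hs : (l ++ r).Pairwise (· < ·)) (hl : ∀ i ∈ l ++ r, i.val < t) :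
    (l.map fun j => permCount fun σ =>
      (IsOpenAt t (l ++ r) σ ∧ NoThreeNesting σ ∧ IncreasingOn l σ) ∧ σ ⟨t, ht⟩ = j).sum =
      removeBox (addStrips (List.replicate r.length 1) g) l.length 0 := by
  cases l with
  | nil => simp [removeBox_zero_zero]
  | cons a l =>
    have hinc (σ : Equiv.Perm (Fin n)) (h : IsOpenAt t (a :: l ++ r) σ) (h' : σ ⟨t, ht⟩ = a)
        (x : Fin n) (hx : x ∈ l) : σ a < σ x := by
      have h1 : σ a = ⟨t, ht⟩ := by rw [← h', h.invol]
      have h2 : (⟨t, ht⟩ : Fin n) ≤ σ x := h.le_apply x (by simp [hx])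
      have h3 : σ a ≠ σ x := fun h => by
        have := hs.nodup
        have := σ.injective h
        grind
      order
    have zero (x : Fin n) (hx : x ∈ l) : permCount (fun σ =>
        (IsOpenAt t (a :: l ++ r) σ ∧ NoThreeNesting σ ∧ IncreasingOn (a :: l) σ) ∧
          σ ⟨t, ht⟩ = x) = 0 := by
      refine permCount_eq_zero fun σ hσ => ?_
      obtain ⟨⟨h1, -, h2⟩, h3⟩ := hσ
      have h4 : σ a < σ x := (List.pairwise_cons.1 h2).1 x hx
      have h5 := h1.le_apply a (by simp)
      rw [← h3, h1.invol] at h4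
      exact absurd h4 (not_lt.2 h5)
    have step := permCount_close ht (l₁ := []) (l₂ := l ++ r) hl hs.nodup
      (P := fun σ => NoThreeNesting σ ∧ IncreasingOn (a :: l) σ)
      (P' := fun σ => NoThreeNesting σ ∧ IncreasingOn l σ) fun σ h h' => by
        rw [noThreeNesting_close_iff ht hs hl h h', IncreasingOn.congr (l := l)
          fun i hi => mul_swap_apply_of_mem ht (l := []) hs hl σ (List.mem_append_left r hi)]
        have h1 : IncreasingOn (a :: l) σ ↔ IncreasingOn l σ :=
          List.pairwise_cons.trans (and_iff_right (hinc σ h h'))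
        have h2 : IncreasingOn [] σ := List.Pairwise.nil
        tauto
    have hz : (l.map fun _ => 0).sum = 0 := by simp
    rw [List.map_cons, List.sum_cons, List.map_congr_left zero, hz, add_zero]
    refine (step.trans (ih l r ?_ ?_)).trans ?_
    · exact (List.pairwise_cons.1 hs).2
    · intro i hi
      have := hl i (List.mem_cons_of_mem a hi)
      omega
    · rw [List.length_cons, removeBox_zero]

theorem permCount_nesting (s t : ℕ) (hst : t + s = n) (l r : List (Fin n))
    (hs : (l ++ r).Pairwise (· < ·)) (hl : ∀ i ∈ l ++ r, i.val < t) :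
    permCount (fun σ => IsOpenAt t (l ++ r) σ ∧ NoThreeNesting σ ∧ IncreasingOn l σ) =
      addStrips (List.replicate r.length 1) (walkCount s) l.length 0 := by
  induction s generalizing t l r with
  | zero =>
    obtain rfl : t = n := hst
    rw [walkCount, addStrips_emptyShape _ (by simp), List.sum_replicate, smul_eq_mul, mul_one,
      ← List.length_append]
    refine permCount_end fun h => ⟨fun i j k hij hjk hk => absurd hk (lt_irrefl k), ?_⟩
    rw [(List.append_eq_nil_iff.1 h).1]
    exact List.Pairwise.nil
  | succ s ih =>
    have ht : t < n := by omega
    have ih' := ih (t + 1) (by omega)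
    rw [permCount_scan ht hl hs.nodup, walkCount, addStrips_add, addStrips_add, Pi.add_apply,
      Pi.add_apply, Pi.add_apply, Pi.add_apply, addStrips_replicate_one_removeBox _ _ (by simp),
      if_pos rfl, List.map_append, List.sum_append]
    congr 1
    · congr 1
      · exact ih' l r hs fun i hi => by have := hl i hi; omega
      · have := ih' l (r ++ [⟨t, ht⟩]) ?_ ?_
        · rw [List.length_append, List.length_singleton, List.replicate_add,
            addStrips_append] at this
          rw [List.append_assoc]
          exact this
        · rw [← List.append_assoc, List.pairwise_append]
          refine ⟨hs, by simp, fun x hx y hy => ?_⟩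
          rw [List.mem_singleton] at hy
          rw [hy]
          exact hl x hx
        · rw [← List.append_assoc]
          intro i hi
          rw [List.mem_append, List.mem_singleton] at hi
          obtain hi | rfl := hi
          · have := hl i hi
            omega
          · simp
    · congr 1
      · exact nesting_close_sum_left ht (walkCount s) ih' l r hs hl
      · have := nesting_close_sum_right ht (walkCount s) ih' l [] r (by simpa using hs)
          (by simpa using hl)
        simpa using this

end Nesting

section Patterns

variable {n : ℕ}

theorem permContains_p456123_iff {σ : Equiv.Perm (Fin n)} (hσ : ∀ i, σ (σ i) = i) :
    PermContains σ p456123 ↔ ¬ NoThreeCrossing σ := by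
  constructor
  · rintro ⟨f, hf, h⟩ hC
    have f01 : f 0 < f 1 := hf (by decide)
    have f12 : f 1 < f 2 := hf (by decide)
    have f23 : f 2 < f 3 := hf (by decide)
    have f34 : f 3 < f 4 := hf (by decide)
    have f45 : f 4 < f 5 := hf (by decide)
    have h01 := (h 0 1).1 (by decide)
    have h12 := (h 1 2).1 (by decide)
    have h50 := (h 5 0).1 (by decide)
    have h34 := (h 3 4).1 (by decide)
    have h45 := (h 4 5).1 (by decide)
    by_cases hlt : f 2 < σ (f 0)
    · exact hC _ _ _ f01 f12 hlt h01 h12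
    · refine hC _ _ _ h34 h45 ?_ ?_ ?_
      · rw [hσ]; order
      · rw [hσ, hσ]; order
      · rw [hσ, hσ]; order
  · intro hC
    simp only [NoThreeCrossing, not_forall, not_not] at hC
    obtain ⟨i, j, k, hij, hjk, hki, hij', hjk'⟩ := hC
    refine ⟨![i, j, k, σ i, σ j, σ k], ?_, ?_⟩
    · rw [Fin.strictMono_iff_lt_succ]
      intro a
      fin_cases a <;> assumption
    · intro a b
      fin_cases a <;> fin_cases b <;> simp [p456123, hσ] <;> order

theorem permContains_p654321_iff {σ : Equiv.Perm (Fin n)} (hσ : ∀ i, σ (σ i) = i) :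
    PermContains σ p654321 ↔ ¬ NoThreeNesting σ := by
  constructor
  · rintro ⟨f, hf, h⟩ hN
    have f01 : f 0 < f 1 := hf (by decide)
    have f12 : f 1 < f 2 := hf (by decide)
    have f23 : f 2 < f 3 := hf (by decide)
    have f34 : f 3 < f 4 := hf (by decide)
    have f45 : f 4 < f 5 := hf (by decide)
    have h10 := (h 1 0).1 (by decide)
    have h21 := (h 2 1).1 (by decide)
    have h32 := (h 3 2).1 (by decide)
    have h43 := (h 4 3).1 (by decide)
    have h54 := (h 5 4).1 (by decide)
    by_cases hlt : f 2 < σ (f 2)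
    · exact hN _ _ _ f01 f12 hlt h21 h10
    · refine hN _ _ _ h54 h43 ?_ ?_ ?_
      · rw [hσ]; order
      · rw [hσ, hσ]; order
      · rw [hσ, hσ]; order
  · intro hN
    simp only [NoThreeNesting, not_forall, not_not] at hN
    obtain ⟨i, j, k, hij, hjk, hk, hkj, hji⟩ := hN
    refine ⟨![i, j, k, σ k, σ j, σ i], ?_, ?_⟩
    · rw [Fin.strictMono_iff_lt_succ]
      intro a
      fin_cases a <;> assumption
    · intro a b
      fin_cases a <;> fin_cases b <;> simp [p654321, hσ] <;> order

theorem iAvoidCount_eq_permCount {k : ℕ} (τ : Equiv.Perm (Fin k))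
    {Q : Equiv.Perm (Fin n) → Prop}
    (h : ∀ σ : Equiv.Perm (Fin n), (∀ i, σ (σ i) = i) → (PermContains σ τ ↔ ¬ Q σ)) :
    IAvoidCount n τ = permCount fun σ => IsOpenAt 0 [] σ ∧ Q σ := by
  classical
  have key (σ : Equiv.Perm (Fin n)) :
      (σ⁻¹ = σ ∧ ¬ PermContains σ τ) ↔ IsOpenAt 0 [] σ ∧ Q σ := by
    have h1 : σ⁻¹ = σ ↔ ∀ i, σ (σ i) = i := by
      rw [inv_eq_iff_mul_eq_one, Equiv.ext_iff]
      rfl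
    have h2 : IsOpenAt 0 [] σ ↔ ∀ i, σ (σ i) = i :=
      ⟨fun h => h.invol, fun h => ⟨h, by simp, by simp⟩⟩
    rw [h1, h2]
    refine and_congr_right fun hσ => ?_
    rw [h σ hσ, not_not]
  rw [permCount, IAvoidCount, ← Set.ncard_coe_finset]
  congr 1
  ext σ
  simp [key]

end Patterns

/-- |I_n(654321)| = |I_n(456123)| for every n ≥ 1. -/
theorem stmt6 : ∀ n : ℕ, 1 ≤ n → IAvoidCount n p654321 = IAvoidCount n p456123 := by
  intro n _
  rw [iAvoidCount_eq_permCount p654321 fun _ => permContains_p654321_iff,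
    iAvoidCount_eq_permCount p456123 fun _ => permContains_p456123_iff]
  have hN := permCount_nesting n 0 (zero_add n) [] [] (by simp) (by simp)
  have hC := permCount_crossing n 0 (zero_add n) [] (by simp) (by simp)
  simp only [IncreasingOn, DecreasingOn, List.append_nil, List.flatten_nil, List.not_mem_nil,
    List.Pairwise.nil, false_imp_iff, implies_true, and_true] at hN hC
  rw [hN, hC]
  rfl
end
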